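/- arXiv:physics/0412157 — 5 statements merged into one kernel-verified Lean document; each statement's English description precedes it below -/
import Mathlib

section
/- Let F : ℝ^k → ℝ be continuous and 2π-periodic in each of its k arguments, with Fourier coefficients F_m := (2π)^{−k} ∫_{[0,2π]^k} F(z) e^{−i m·z} dz for m ∈ ℤ^k. Define, for each natural number N, Σ_N(z) := Σ_{m ∈ ℤ^k, ‖m‖ ≤ N} A_{N,m} F_m e^{i m·z}, where ‖m‖ := max_n |m_n| and A_{N,m} := ∏_{n=1}^{k} (N+1−|m_n|)/(N+1). Then the sequence (Σ_N) converges uniformly on ℝ^k to F. -/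
open MeasureTheory Filter
noncomputable section

/-- The matrix 𝒥: (2,1)-entry 1, (1,2)-entry −1, all other entries 0. -/
def Jmat : Matrix (Fin 3) (Fin 3) ℝ := Matrix.of ![![0, -1, 0], ![1, 0, 0], ![0, 0, 0]]

/-- The special orthogonal group SO(3): RᵀR = I and det R = 1. -/
def SO3 : Set (Matrix (Fin 3) (Fin 3) ℝ) := {R | R.transpose * R = 1 ∧ R.det = 1}

/-- 2π-periodicity in each of the k arguments. -/
def Periodic2Pi {k : ℕ} {E : Type*} (F : (Fin k → ℝ) → E) : Prop :=
  ∀ (z : Fin k → ℝ) (i : Fin k), F (Function.update z i (z i + 2 * Real.pi)) = F z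

/-- `f : ℝ → E` is quasiperiodic with tune vector `ν ∈ ℝ^k` if `f θ = F (νθ)` for a
continuous `F` that is 2π-periodic in each argument. -/
def IsQuasiperiodic {E : Type*} [TopologicalSpace E] {k : ℕ} (ν : Fin k → ℝ) (f : ℝ → E) : Prop :=
  ∃ F : (Fin k → ℝ) → E, Continuous F ∧ Periodic2Pi F ∧ ∀ θ : ℝ, f θ = F fun i => ν i * θ

/-- integer dot product `m · v` -/
def zdot {k : ℕ} (m : Fin k → ℤ) (v : Fin k → ℝ) : ℝ := ∑ i, (m i : ℝ) * v i

/-- `ν` is nonresonant if `m · ν = 0` only for `m = 0`. -/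
def Nonresonant {k : ℕ} (ν : Fin k → ℝ) : Prop :=
  ∀ m : Fin k → ℤ, zdot m ν = 0 → m = 0

/-- Fourier coefficient `F_m = (2π)^{-k} ∫_{[0,2π]^k} F(z) e^{-i m·z} dz`. -/
def mFourierCoeff {k : ℕ} (F : (Fin k → ℝ) → ℂ) (m : Fin k → ℤ) : ℂ :=
  ((2 * Real.pi) ^ k : ℝ)⁻¹ •
    ∫ z in Set.Icc (0 : Fin k → ℝ) (fun _ => 2 * Real.pi),
      F z * Complex.exp (-Complex.I * ∑ i, (m i : ℝ) * z i)

/-- The phase space `ℝ × ℝ^d` of pairs `(θ, φ)`. -/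
abbrev Pt (d : ℕ) := ℝ × (Fin d → ℝ)

/-- The vector `(1, ω) ∈ ℝ^{d+1}`. -/
def oneOmega {d : ℕ} (ω : Fin d → ℝ) : Fin (d + 1) → ℝ := Fin.cons 1 ω

/-- max norm `‖m‖ = max_i |m_i|` of an integer vector. -/
def intNorm {k : ℕ} (m : Fin k → ℤ) : ℕ := Finset.univ.sup fun i => (m i).natAbs

/-- The Diophantine set `Ω(τ) = ⋃_{γ ∈ (0,1]} Ω(τ,γ)` where
`Ω(τ,γ) = {ω : |m·(1,ω)| ≥ γ‖m‖^{-τ} for all nonzero m ∈ ℤ^{d+1}}`. -/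
def DiophSet (d : ℕ) (τ : ℝ) : Set (Fin d → ℝ) :=
  ⋃ γ ∈ Set.Ioc (0 : ℝ) 1,
    {ω | ∀ m : Fin (d + 1) → ℤ, m ≠ 0 → γ * (intNorm m : ℝ) ^ (-τ) ≤ |zdot m (oneOmega ω)|}

/-- The derivation 𝒟 applied to the entries of a matrix-valued function:
`(𝒟V)(p) = ∂_θ V + ω·∇_φ V`, i.e. the directional derivative along `(1, ω)`. -/
def Dmat {d : ℕ} (ω : Fin d → ℝ) (V : Pt d → Matrix (Fin 3) (Fin 3) ℝ) (p : Pt d) :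
    Matrix (Fin 3) (Fin 3) ℝ :=
  Matrix.of fun i j => fderiv ℝ (fun q => V q i j) p (1, ω)

/-- Periodicity: 2π-periodic in θ and in each component of φ. -/
def PeriodicPt {d : ℕ} {E : Type*} (f : Pt d → E) : Prop :=
  (∀ p : Pt d, f (p.1 + 2 * Real.pi, p.2) = f p) ∧
  (∀ (p : Pt d) (i : Fin d), f (p.1, Function.update p.2 i (p.2 i + 2 * Real.pi)) = f p)

/-- A matrix-valued map on `ℝ × ℝ^d` is of class `C^n` (entrywise). -/
def SmoothMat {d : ℕ} (n : ℕ∞) (V : Pt d → Matrix (Fin 3) (Fin 3) ℝ) : Prop :=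
  ∀ i j, ContDiff ℝ n fun p => V p i j

/-- `Φ` is the principal solution matrix at `φ₀`:
`∂_θ Φ(θ) = 𝒜(θ, ωθ + φ₀) Φ(θ)`, `Φ(0) = I`. -/
def IsPrincipalSolution {d : ℕ} (ω : Fin d → ℝ) (𝒜 : Pt d → Matrix (Fin 3) (Fin 3) ℝ)
    (φ₀ : Fin d → ℝ) (Φ : ℝ → Matrix (Fin 3) (Fin 3) ℝ) : Prop :=
  Φ 0 = 1 ∧ ∀ (θ : ℝ) (i j : Fin 3),
    HasDerivAt (fun t => Φ t i j) ((𝒜 (θ, fun l => ω l * θ + φ₀ l) * Φ θ) i j) θ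

/-- A uniform invariant frame field: C¹, 2π-periodic, SO(3)-valued, satisfying
`𝒟𝒱 = 𝒜𝒱 − ν𝒱𝒥` for a constant `ν ∈ [0,1)`. -/
def IsUniformIFF {d : ℕ} (ω : Fin d → ℝ) (𝒜 V : Pt d → Matrix (Fin 3) (Fin 3) ℝ) (ν : ℝ) :
    Prop :=
  SmoothMat 1 V ∧ PeriodicPt V ∧ (∀ p, V p ∈ SO3) ∧ ν ∈ Set.Ico (0 : ℝ) 1 ∧
  ∀ p, Dmat ω V p = 𝒜 p * V p - ν • (V p * Jmat)

/-- An invariant frame field: C¹, 2π-periodic, SO(3)-valued, whose third column 𝔳³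
satisfies `𝒟𝔳³ = 𝒜𝔳³`. -/
def IsIFF {d : ℕ} (ω : Fin d → ℝ) (𝒜 V : Pt d → Matrix (Fin 3) (Fin 3) ℝ) : Prop :=
  SmoothMat 1 V ∧ PeriodicPt V ∧ (∀ p, V p ∈ SO3) ∧
  ∀ (p : Pt d) (i : Fin 3),
    fderiv ℝ (fun q => V q i 2) p (1, ω) = ((𝒜 p).mulVec fun j => V p j 2) i

/-- An invariant spin field: C¹, 2π-periodic, unit length, satisfying `𝒟n = 𝒜n`. -/
def IsISF {d : ℕ} (ω : Fin d → ℝ) (𝒜 : Pt d → Matrix (Fin 3) (Fin 3) ℝ)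
    (n : Pt d → Fin 3 → ℝ) : Prop :=
  (∀ i, ContDiff ℝ 1 fun p => n p i) ∧ PeriodicPt n ∧ (∀ p, ∑ i, n p i ^ 2 = 1) ∧
  ∀ (p : Pt d) (i : Fin 3), fderiv ℝ (fun q => n q i) p (1, ω) = ((𝒜 p).mulVec (n p)) i

/-- cross product on ℝ³ -/
def cross3 (u v : Fin 3 → ℝ) : Fin 3 → ℝ :=
  ![u 1 * v 2 - u 2 * v 1, u 2 * v 0 - u 0 * v 2, u 0 * v 1 - u 1 * v 0]

/-- Euclidean norm on ℝ³ -/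
def nrm3 (v : Fin 3 → ℝ) : ℝ := Real.sqrt (∑ i, v i ^ 2)

/-- normalization of a vector in ℝ³ -/
def unitize (v : Fin 3 → ℝ) : Fin 3 → ℝ := fun i => v i / nrm3 v

/-- the matrix with columns a, b, c -/
def colMat (a b c : Fin 3 → ℝ) : Matrix (Fin 3) (Fin 3) ℝ := (Matrix.of ![a, b, c]).transpose

theorem sum_Icc_neg_succ {M : Type*} [AddCommMonoid M] (f : ℤ → M) (N : ℕ) :
    ∑ j ∈ Finset.Icc (-((N + 1 : ℕ) : ℤ)) ((N + 1 : ℕ) : ℤ), f j =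
      ∑ j ∈ Finset.Icc (-(N : ℤ)) N, f j + (f (N + 1) + f (-(N + 1))) := by
  have h : Finset.Icc (-((N + 1 : ℕ) : ℤ)) ((N + 1 : ℕ) : ℤ) =
      insert ((N : ℤ) + 1) (insert (-((N : ℤ) + 1)) (Finset.Icc (-(N : ℤ)) N)) := by
    ext j
    simp only [Finset.mem_Icc, Finset.mem_insert]
    omega
  rw [h, Finset.sum_insert, Finset.sum_insert, add_comm (f (-(N + 1))), ← add_assoc,
    add_comm (f _), add_assoc]
  · simp
  · simp only [Finset.mem_Icc, Finset.mem_insert]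
    omega

theorem sum_Icc_zpow (u : ℂ) (N : ℕ) :
    ∑ j ∈ Finset.Icc (-(N : ℤ)) N, u ^ j =
      ∑ a ∈ Finset.range (N + 1), u ^ a + ∑ a ∈ Finset.range (N + 1), u⁻¹ ^ a - 1 := by
  induction N with
  | zero => simp
  | succ N ih =>
    rw [sum_Icc_neg_succ, ih, Finset.sum_range_succ _ (N + 1), Finset.sum_range_succ _ (N + 1),
      zpow_neg, ← inv_zpow]
    norm_cast
    ring

theorem inv_pow_mul_sum_range_pow {u : ℂ} (hu : u ≠ 0) (N : ℕ) :
    u⁻¹ ^ N * ∑ a ∈ Finset.range (N + 1), u ^ a = ∑ a ∈ Finset.range (N + 1), u⁻¹ ^ a := by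
  induction N with
  | zero => simp
  | succ N ih =>
    rw [Finset.sum_range_succ, mul_add, pow_succ' u⁻¹, mul_assoc, ih,
      Finset.sum_range_succ' _ (N + 1), Finset.mul_sum]
    simp only [pow_succ', pow_zero, inv_pow]
    field_simp

theorem sum_Icc_fejer_zpow {u : ℂ} (hu : u ≠ 0) (N : ℕ) :
    ∑ j ∈ Finset.Icc (-(N : ℤ)) N, ((N : ℂ) + 1 - (|j| : ℤ)) * u ^ j =
      (∑ a ∈ Finset.range (N + 1), u ^ a) * ∑ a ∈ Finset.range (N + 1), u⁻¹ ^ a := by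
  induction N with
  | zero => simp
  | succ N ih =>
    have h1 := inv_pow_mul_sum_range_pow hu (N + 1)
    have h2 := inv_pow_mul_sum_range_pow (inv_ne_zero hu) (N + 1)
    have h3 : ∑ j ∈ Finset.Icc (-(N : ℤ)) N, (((N + 1 : ℕ) : ℂ) + 1 - (|j| : ℤ)) * u ^ j =
        ∑ j ∈ Finset.Icc (-(N : ℤ)) N, ((N : ℂ) + 1 - (|j| : ℤ)) * u ^ j +
          ∑ j ∈ Finset.Icc (-(N : ℤ)) N, u ^ j := by
      rw [← Finset.sum_add_distrib]
      refine Finset.sum_congr rfl fun j _ => ?_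
      push_cast
      ring
    have h4 : |(N : ℤ) + 1| = N + 1 := abs_of_nonneg (by positivity)
    have h5 : u ^ (N + 1) * u⁻¹ ^ (N + 1) = 1 := by
      rw [← mul_pow, mul_inv_cancel₀ hu, one_pow]
    have h6 : ((N : ℤ) + 1) = ((N + 1 : ℕ) : ℤ) := by push_cast; ring
    rw [inv_inv, Finset.sum_range_succ _ (N + 1), Finset.sum_range_succ _ (N + 1)] at h2
    rw [Finset.sum_range_succ _ (N + 1), Finset.sum_range_succ _ (N + 1)] at h1
    rw [sum_Icc_neg_succ, h3, ih, sum_Icc_zpow, abs_neg, h4, Finset.sum_range_succ _ (N + 1),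
      Finset.sum_range_succ _ (N + 1), zpow_neg, ← inv_zpow, h6, zpow_natCast, zpow_natCast]
    push_cast
    linear_combination h5 - h1 - h2

/-- The one-dimensional Fejér kernel. -/
def fejerKernel (N : ℕ) (x : ℝ) : ℝ :=
  ‖∑ a ∈ Finset.range (N + 1), Complex.exp (Complex.I * x) ^ a‖ ^ 2 / (N + 1)

theorem fejerKernel_nonneg (N : ℕ) (x : ℝ) : 0 ≤ fejerKernel N x := by
  unfold fejerKernel
  positivity

theorem continuous_fejerKernel (N : ℕ) : Continuous (fejerKernel N) := by
  unfold fejerKernel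
  fun_prop

/-- The weight of the frequency `j` in the one-dimensional Fejér mean. -/
def fejerWeight (N : ℕ) (j : ℤ) : ℝ := ((N : ℝ) + 1 - |(j : ℝ)|) / ((N : ℝ) + 1)

theorem sum_fejerWeight_mul_exp (N : ℕ) (x : ℝ) :
    ∑ j ∈ Finset.Icc (-(N : ℤ)) N, (fejerWeight N j : ℂ) * Complex.exp (Complex.I * (j * x)) =
      fejerKernel N x := by
  have hN : (N : ℂ) + 1 ≠ 0 := by exact_mod_cast N.succ_ne_zero
  have h := sum_Icc_fejer_zpow (Complex.exp_ne_zero (Complex.I * x)) N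
  have hc : ∑ a ∈ Finset.range (N + 1), (Complex.exp (Complex.I * x))⁻¹ ^ a =
      (starRingEnd ℂ) (∑ a ∈ Finset.range (N + 1), Complex.exp (Complex.I * x) ^ a) := by
    simp [← Complex.exp_neg, ← Complex.exp_conj]
  rw [hc, Complex.mul_conj, Complex.normSq_eq_norm_sq] at h
  rw [fejerKernel, Complex.ofReal_div, ← h, Finset.sum_div]
  refine Finset.sum_congr rfl fun j _ => ?_
  have hj : ((|j| : ℤ) : ℂ) = ((|(j : ℝ)| : ℝ) : ℂ) := by
    rw [← Int.cast_abs, Complex.ofReal_intCast]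
  rw [← Complex.exp_int_mul, fejerWeight, hj]
  push_cast
  rw [show (j : ℂ) * (Complex.I * x) = Complex.I * (j * x) by ring]
  ring

theorem integral_exp_int_mul (j : ℤ) :
    ∫ x in Set.Icc 0 (2 * Real.pi), Complex.exp (Complex.I * (j * (x : ℂ))) =
      if j = 0 then ((2 * Real.pi : ℝ) : ℂ) else 0 := by
  rw [integral_Icc_eq_integral_Ioc, ← intervalIntegral.integral_of_le (by positivity)]
  split_ifs with h
  · simp [h]
  · have hc : Complex.I * (j : ℂ) ≠ 0 := by simp [h]
    simp_rw [← mul_assoc]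
    rw [integral_exp_mul_complex hc]
    have : Complex.exp (Complex.I * j * ((2 * Real.pi : ℝ) : ℂ)) = 1 :=
      Complex.exp_eq_one_iff.2 ⟨j, by push_cast; ring⟩
    rw [this]
    simp

theorem integral_fejerKernel (N : ℕ) (z : ℝ) :
    ∫ w in Set.Icc 0 (2 * Real.pi), fejerKernel N (z - w) = 2 * Real.pi := by
  apply Complex.ofReal_injective
  rw [← integral_complex_ofReal]
  simp_rw [← sum_fejerWeight_mul_exp]
  rw [integral_finsetSum _ fun j _ => Continuous.integrableOn_Icc (by fun_prop)]
  have h (j : ℤ) (w : ℝ) : (fejerWeight N j : ℂ) * Complex.exp (Complex.I * (j * (z - w : ℝ))) =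
      (fejerWeight N j * Complex.exp (Complex.I * (j * z))) *
        Complex.exp (Complex.I * ((-j : ℤ) * w)) := by
    rw [mul_assoc, ← Complex.exp_add]
    congr 2
    push_cast
    ring
  have hN : (N : ℂ) + 1 ≠ 0 := by exact_mod_cast N.succ_ne_zero
  simp_rw [h, integral_const_mul, integral_exp_int_mul]
  simp [fejerWeight, hN]

theorem integral_Icc_prod {𝕜 : Type*} [RCLike 𝕜] {k : ℕ} (f : Fin k → ℝ → 𝕜) :
    ∫ z in Set.Icc (0 : Fin k → ℝ) (fun _ => 2 * Real.pi), ∏ i, f i (z i) =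
      ∏ i, ∫ x in Set.Icc 0 (2 * Real.pi), f i x := by
  rw [← Set.pi_univ_Icc, volume_pi, Measure.restrict_pi_pi]
  exact integral_fintype_prod_eq_prod f

/-- The exponential monomial `z ↦ e^{i m·z}`. -/
def expMonomial {k : ℕ} (m : Fin k → ℤ) (z : Fin k → ℝ) : ℂ :=
  Complex.exp (Complex.I * ∑ i, (m i : ℝ) * z i)

theorem continuous_expMonomial {k : ℕ} (m : Fin k → ℤ) : Continuous (expMonomial m) := by
  unfold expMonomial
  fun_prop

theorem norm_expMonomial {k : ℕ} (m : Fin k → ℤ) (z : Fin k → ℝ) : ‖expMonomial m z‖ = 1 := by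
  rw [expMonomial, mul_comm, Complex.norm_exp_ofReal_mul_I]

theorem expMonomial_eq_prod {k : ℕ} (m : Fin k → ℤ) (z : Fin k → ℝ) :
    expMonomial m z = ∏ i, Complex.exp (Complex.I * (m i * z i)) := by
  rw [expMonomial, ← Complex.exp_sum, ← Finset.mul_sum]
  push_cast
  rfl

theorem mFourierCoeff_expMonomial {k : ℕ} (m n : Fin k → ℤ) :
    mFourierCoeff (expMonomial m) n = if n = m then 1 else 0 := by
  have h (z : Fin k → ℝ) : expMonomial m z * Complex.exp (-Complex.I * ∑ i, (n i : ℝ) * z i) =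
      ∏ i, Complex.exp (Complex.I * ((m i - n i : ℤ) * (z i : ℂ))) := by
    rw [← Complex.exp_sum, expMonomial, ← Complex.exp_add, ← Finset.mul_sum]
    push_cast
    simp only [sub_mul, Finset.sum_sub_distrib]
    congr 1
    ring
  have hpi : ((2 * Real.pi : ℝ) : ℂ) ≠ 0 := by
    exact_mod_cast (mul_pos two_pos Real.pi_pos).ne'
  unfold mFourierCoeff
  simp_rw [h]
  rw [integral_Icc_prod fun i x => Complex.exp (Complex.I * ((m i - n i : ℤ) * (x : ℂ)))]
  simp_rw [integral_exp_int_mul]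
  split_ifs with hmn
  · subst hmn
    simp only [sub_self, if_true, Finset.prod_const, Finset.card_univ, Fintype.card_fin,
      Complex.real_smul, Complex.ofReal_inv, Complex.ofReal_pow]
    exact inv_mul_cancel₀ (pow_ne_zero _ hpi)
  · obtain ⟨i, hi⟩ := Function.ne_iff.1 hmn
    rw [Finset.prod_eq_zero (Finset.mem_univ i), smul_zero]
    rw [if_neg]
    exact fun h0 => hi (sub_eq_zero.1 h0).symm

theorem mFourierCoeff_add {k : ℕ} {F G : (Fin k → ℝ) → ℂ} (hF : Continuous F) (hG : Continuous G)
    (m : Fin k → ℤ) : mFourierCoeff (F + G) m = mFourierCoeff F m + mFourierCoeff G m := by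
  unfold mFourierCoeff
  simp_rw [Pi.add_apply, add_mul]
  rw [integral_add, smul_add]
  all_goals exact Continuous.integrableOn_Icc (by fun_prop)

theorem mFourierCoeff_smul {k : ℕ} (c : ℂ) (F : (Fin k → ℝ) → ℂ) (m : Fin k → ℤ) :
    mFourierCoeff (c • F) m = c * mFourierCoeff F m := by
  unfold mFourierCoeff
  simp_rw [Pi.smul_apply, smul_eq_mul, mul_assoc]
  rw [integral_const_mul, mul_smul_comm]

/-- The multiple Fejér mean of order `N`. -/
def fejerMean {k : ℕ} (F : (Fin k → ℝ) → ℂ) (N : ℕ) (z : Fin k → ℝ) : ℂ :=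
  ∑ m ∈ Fintype.piFinset fun _ : Fin k => Finset.Icc (-(N : ℤ)) N,
    ((∏ n, fejerWeight N (m n) : ℝ) : ℂ) * mFourierCoeff F m * expMonomial m z

theorem fejerMean_add {k : ℕ} {F G : (Fin k → ℝ) → ℂ} (hF : Continuous F) (hG : Continuous G)
    (N : ℕ) : fejerMean (F + G) N = fejerMean F N + fejerMean G N := by
  ext z
  simp only [fejerMean, mFourierCoeff_add hF hG, Pi.add_apply, mul_add, add_mul,
    Finset.sum_add_distrib]

theorem fejerMean_smul {k : ℕ} (c : ℂ) (F : (Fin k → ℝ) → ℂ) (N : ℕ) :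
    fejerMean (c • F) N = c • fejerMean F N := by
  ext z
  simp only [fejerMean, mFourierCoeff_smul, Pi.smul_apply, smul_eq_mul, Finset.mul_sum]
  exact Finset.sum_congr rfl fun m _ => by ring

theorem fejerMean_expMonomial {k : ℕ} (m : Fin k → ℤ) {N : ℕ}
    (hN : m ∈ Fintype.piFinset fun _ : Fin k => Finset.Icc (-(N : ℤ)) N) (z : Fin k → ℝ) :
    fejerMean (expMonomial m) N z = ((∏ n, fejerWeight N (m n) : ℝ) : ℂ) * expMonomial m z := by
  rw [fejerMean, Finset.sum_eq_single_of_mem m hN]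
  · simp [mFourierCoeff_expMonomial]
  · intro n _ hnm
    simp [mFourierCoeff_expMonomial, hnm]

theorem fejerMean_eq_integral {k : ℕ} {F : (Fin k → ℝ) → ℂ} (hF : Continuous F) (N : ℕ)
    (z : Fin k → ℝ) :
    fejerMean F N z = ((2 * Real.pi) ^ k : ℝ)⁻¹ •
      ∫ w in Set.Icc (0 : Fin k → ℝ) (fun _ => 2 * Real.pi),
        F w * ((∏ i, fejerKernel N (z i - w i) : ℝ) : ℂ) := by
  have h (w : Fin k → ℝ) : F w * ((∏ i, fejerKernel N (z i - w i) : ℝ) : ℂ) =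
      ∑ m ∈ Fintype.piFinset fun _ : Fin k => Finset.Icc (-(N : ℤ)) N,
        ((∏ n, fejerWeight N (m n) : ℝ) : ℂ) * expMonomial m z *
          (F w * Complex.exp (-Complex.I * ∑ i, (m i : ℝ) * w i)) := by
    rw [Complex.ofReal_prod]
    simp_rw [← sum_fejerWeight_mul_exp]
    rw [Finset.prod_univ_sum, Finset.mul_sum]
    refine Finset.sum_congr rfl fun m _ => ?_
    rw [Finset.prod_mul_distrib, ← Complex.ofReal_prod, ← Complex.exp_sum, ← Finset.mul_sum,
      mul_mul_mul_comm, expMonomial, mul_left_comm, mul_assoc, ← Complex.exp_add]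
    push_cast
    simp only [mul_sub, Finset.sum_sub_distrib]
    congr 3
    ring
  simp_rw [h]
  rw [integral_finsetSum _ fun m _ => Continuous.integrableOn_Icc (by fun_prop), Finset.smul_sum]
  refine Finset.sum_congr rfl fun m _ => ?_
  rw [integral_const_mul, mFourierCoeff, mul_right_comm, mul_smul_comm]

theorem norm_fejerMean_le {k : ℕ} {F : (Fin k → ℝ) → ℂ} (hF : Continuous F) {C : ℝ}
    (hC : ∀ w, ‖F w‖ ≤ C) (N : ℕ) (z : Fin k → ℝ) : ‖fejerMean F N z‖ ≤ C := by
  have hK := continuous_fejerKernel N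
  have hP (w : Fin k → ℝ) : 0 ≤ ∏ i, fejerKernel N (z i - w i) :=
    Finset.prod_nonneg fun i _ => fejerKernel_nonneg N _
  have hpos : 0 < (2 * Real.pi) ^ k := by positivity
  have hint : ∫ w in Set.Icc (0 : Fin k → ℝ) (fun _ => 2 * Real.pi),
      C * ∏ i, fejerKernel N (z i - w i) = C * (2 * Real.pi) ^ k := by
    rw [integral_const_mul, integral_Icc_prod fun i x => fejerKernel N (z i - x)]
    simp [integral_fejerKernel]
  rw [fejerMean_eq_integral hF, norm_smul, norm_inv, Real.norm_of_nonneg hpos.le,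
    inv_mul_le_iff₀ hpos, mul_comm _ C, ← hint]
  refine norm_integral_le_of_norm_le (Continuous.integrableOn_Icc (by fun_prop))
    (Eventually.of_forall fun w => ?_)
  rw [norm_mul, Complex.norm_real, Real.norm_of_nonneg (hP w)]
  exact mul_le_mul_of_nonneg_right (hC w) (hP w)

theorem tendsto_fejerWeight (j : ℤ) : Tendsto (fun N : ℕ => fejerWeight N j) atTop (nhds 1) := by
  have h : Tendsto (fun N : ℕ => 1 - |(j : ℝ)| * (1 / ((N : ℝ) + 1))) atTop
      (nhds (1 - |(j : ℝ)| * 0)) :=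
    tendsto_const_nhds.sub (tendsto_one_div_add_atTop_nhds_zero_nat.const_mul _)
  rw [mul_zero, sub_zero] at h
  refine h.congr fun N => ?_
  have hN : (N : ℝ) + 1 ≠ 0 := by positivity
  rw [fejerWeight]
  field_simp

theorem tendstoUniformly_fejerMean_expMonomial {k : ℕ} (m : Fin k → ℤ) :
    TendstoUniformly (fejerMean (expMonomial m)) (expMonomial m) atTop := by
  have hw : Tendsto (fun N : ℕ => ∏ n, fejerWeight N (m n)) atTop (nhds 1) := by
    simpa using tendsto_finsetProd Finset.univ fun n _ => tendsto_fejerWeight (m n)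
  rw [Metric.tendstoUniformly_iff]
  intro ε hε
  filter_upwards [Metric.tendsto_nhds.1 hw ε hε, eventually_ge_atTop (∑ n, (m n).natAbs)]
    with N h1 h2 z
  have hmem : m ∈ Fintype.piFinset fun _ : Fin k => Finset.Icc (-(N : ℤ)) N := by
    rw [Fintype.mem_piFinset]
    intro i
    have := (Finset.single_le_sum (f := fun n => (m n).natAbs) (fun _ _ => Nat.zero_le _)
      (Finset.mem_univ i)).trans h2
    rw [Finset.mem_Icc]
    omega
  rw [fejerMean_expMonomial m hmem, dist_comm, dist_eq_norm, ← sub_one_mul, norm_mul,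
    norm_expMonomial, mul_one, ← Complex.ofReal_one, ← Complex.ofReal_sub, Complex.norm_real]
  exact h1

theorem Periodic2Pi.apply_add_zsmul {k : ℕ} {E : Type*} {F : (Fin k → ℝ) → E}
    (hF : Periodic2Pi F) (z : Fin k → ℝ) (n : Fin k → ℤ) :
    F (z + fun i => n i * (2 * Real.pi)) = F z := by
  have hp (i : Fin k) : Function.Periodic F (Pi.single i (2 * Real.pi)) := fun w => by
    rw [← hF w i]
    congr 1
    ext j
    rcases eq_or_ne j i with rfl | hj <;> simp [*]
  have hs (s : Finset (Fin k)) :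
      Function.Periodic F (∑ i ∈ s, n i • Pi.single i (2 * Real.pi)) := by
    induction s using Finset.cons_induction with
    | empty => simp [Function.Periodic]
    | cons i s hi ih =>
      rw [Finset.sum_cons]
      exact ((hp i).zsmul (n i)).add_period ih
  rw [← hs Finset.univ z]
  congr 2
  ext j
  simp [Finset.sum_apply, Pi.single_apply]

/-- The covering of the torus `(ℝ/ℤ)^k` by `ℝ^k` which turns `2π`-periodicity
into `1`-periodicity. -/
def torusCover (k : ℕ) : C(Fin k → ℝ, UnitAddTorus (Fin k)) where
  toFun := Pi.map fun _ x => ((x * (2 * Real.pi)⁻¹ : ℝ) : UnitAddCircle)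
  continuous_toFun := by
    refine continuous_pi fun i => ?_
    exact (AddCircle.continuous_mk' 1).comp ((continuous_apply i).mul_const _)

theorem isOpenQuotientMap_torusCover (k : ℕ) : IsOpenQuotientMap (torusCover k) :=
  IsOpenQuotientMap.piMap fun _ => QuotientAddGroup.isOpenQuotientMap_mk.comp
    (Homeomorph.mulRight₀ (2 * Real.pi)⁻¹ (by positivity)).isOpenQuotientMap

theorem Periodic2Pi.factorsThrough_torusCover {k : ℕ} {E : Type*} {F : (Fin k → ℝ) → E}
    (hF : Periodic2Pi F) : Function.FactorsThrough F (torusCover k) := by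
  intro z w hzw
  have h (i : Fin k) : ∃ n : ℤ, z i = w i + n * (2 * Real.pi) := by
    have hi : ((z i * (2 * Real.pi)⁻¹ : ℝ) : UnitAddCircle) = ((w i * (2 * Real.pi)⁻¹ : ℝ)) :=
      congrFun hzw i
    rw [← sub_eq_zero, ← AddCircle.coe_sub, AddCircle.coe_eq_zero_iff] at hi
    obtain ⟨n, hn⟩ := hi
    refine ⟨n, ?_⟩
    rw [zsmul_one] at hn
    rw [hn]
    field_simp
    ring
  choose n hn using h
  rw [← hF.apply_add_zsmul w n]
  exact congrArg F (funext hn)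

theorem mFourier_torusCover {k : ℕ} (m : Fin k → ℤ) (z : Fin k → ℝ) :
    UnitAddTorus.mFourier m (torusCover k z) = expMonomial m z := by
  rw [expMonomial_eq_prod]
  change ∏ i, fourier (m i) ((z i * (2 * Real.pi)⁻¹ : ℝ) : UnitAddCircle) = _
  refine Finset.prod_congr rfl fun i _ => ?_
  have hpi : (Real.pi : ℂ) ≠ 0 := by exact_mod_cast Real.pi_ne_zero
  refine fourier_coe_apply.trans (congrArg Complex.exp ?_)
  push_cast
  field_simp

theorem tendstoUniformly_fejerMean_of_mem_span {k : ℕ} {P : C(UnitAddTorus (Fin k), ℂ)}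
    (hP : P ∈ Submodule.span ℂ (Set.range UnitAddTorus.mFourier)) :
    TendstoUniformly (fejerMean (P ∘ torusCover k)) (P ∘ torusCover k) atTop := by
  have hc (Q : C(UnitAddTorus (Fin k), ℂ)) : Continuous (Q ∘ torusCover k) :=
    Q.continuous.comp (torusCover k).continuous
  have hs (c : ℂ) (Q : C(UnitAddTorus (Fin k), ℂ))
      (hQ : TendstoUniformly (fejerMean (Q ∘ torusCover k)) (Q ∘ torusCover k) atTop) :
      TendstoUniformly (fejerMean ((c • Q : C(UnitAddTorus (Fin k), ℂ)) ∘ torusCover k))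
        ((c • Q : C(UnitAddTorus (Fin k), ℂ)) ∘ torusCover k) atTop := by
    have h : fejerMean ((c • Q : C(UnitAddTorus (Fin k), ℂ)) ∘ torusCover k) =
        fun N => c • fejerMean (Q ∘ torusCover k) N :=
      funext fun N => fejerMean_smul c (Q ∘ torusCover k) N
    rw [h]
    exact (uniformContinuous_const_smul c).comp_tendstoUniformly hQ
  induction hP using Submodule.span_induction with
  | mem P hP =>
    obtain ⟨m, rfl⟩ := hP
    have h : UnitAddTorus.mFourier m ∘ torusCover k = expMonomial m :=
      funext (mFourier_torusCover m)
    rw [h]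
    exact tendstoUniformly_fejerMean_expMonomial m
  | zero =>
    have h : fejerMean ((0 : C(UnitAddTorus (Fin k), ℂ)) ∘ torusCover k) = fun _ _ => 0 := by
      ext N z
      simp [fejerMean, mFourierCoeff]
    rw [h]
    exact Metric.tendstoUniformly_iff.2 fun ε hε =>
      Eventually.of_forall fun _ _ => by simpa using hε
  | add P Q _ _ hP hQ =>
    have h : fejerMean ((P + Q : C(UnitAddTorus (Fin k), ℂ)) ∘ torusCover k) =
        fejerMean (P ∘ torusCover k) + fejerMean (Q ∘ torusCover k) :=
      funext fun N => fejerMean_add (hc P) (hc Q) N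
    rw [h]
    exact hP.add hQ
  | smul c P _ hP => exact hs c P hP

theorem tendstoUniformly_fejerMean {k : ℕ} {F : (Fin k → ℝ) → ℂ} (hF : Continuous F)
    (hper : Periodic2Pi F) : TendstoUniformly (fejerMean F) F atTop := by
  obtain ⟨G, hG⟩ : ∃ G : C(UnitAddTorus (Fin k), ℂ), ∀ z, G (torusCover k z) = F z :=
    ⟨(isOpenQuotientMap_torusCover k).isQuotientMap.lift ⟨F, hF⟩ hper.factorsThrough_torusCover,
      fun z => DFunLike.congr_fun ((isOpenQuotientMap_torusCover k).isQuotientMap.lift_comp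
        ⟨F, hF⟩ hper.factorsThrough_torusCover) z⟩
  rw [Metric.tendstoUniformly_iff]
  intro ε hε
  have hGcl : G ∈ (Submodule.span ℂ
      (Set.range (UnitAddTorus.mFourier (d := Fin k)))).topologicalClosure := by
    rw [UnitAddTorus.span_mFourier_closure_eq_top]
    trivial
  obtain ⟨P, hP, hGP⟩ := Metric.mem_closure_iff.1 hGcl (ε / 3) (by positivity)
  have hPc : Continuous (P ∘ torusCover k) := P.continuous.comp (torusCover k).continuous
  have hD (z : Fin k → ℝ) : ‖(F - P ∘ torusCover k) z‖ ≤ ε / 3 := by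
    have := (ContinuousMap.dist_apply_le_dist (torusCover k z)).trans hGP.le
    rwa [dist_eq_norm, hG] at this
  filter_upwards [Metric.tendstoUniformly_iff.1 (tendstoUniformly_fejerMean_of_mem_span hP)
    (ε / 3) (by positivity)] with N hN z
  have hsplit : fejerMean F N z =
      fejerMean (F - P ∘ torusCover k) N z + fejerMean (P ∘ torusCover k) N z := by
    rw [← Pi.add_apply, ← fejerMean_add (hF.sub hPc) hPc, sub_add_cancel]
  have h1 := hD z
  have h2 := norm_fejerMean_le (hF.sub hPc) hD N z
  have h3 := hN z
  rw [dist_eq_norm] at h3 ⊢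
  calc ‖F z - fejerMean F N z‖
      = ‖(F - P ∘ torusCover k) z +
          ((P ∘ torusCover k) z - fejerMean (P ∘ torusCover k) N z) -
          fejerMean (F - P ∘ torusCover k) N z‖ := by
        rw [hsplit, Pi.sub_apply]
        congr 1
        ring
    _ ≤ ‖(F - P ∘ torusCover k) z‖ + ‖(P ∘ torusCover k) z - fejerMean (P ∘ torusCover k) N z‖ +
          ‖fejerMean (F - P ∘ torusCover k) N z‖ :=
        (norm_sub_le _ _).trans (add_le_add_left (norm_add_le _ _) _)
    _ < ε := by linarith

/-- Lemma 4.3a, multidimensional Fejér theorem. -/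
theorem multidim_fejer {k : ℕ} (F : (Fin k → ℝ) → ℝ) (hF : Continuous F)
    (hper : Periodic2Pi F) :
    TendstoUniformly
      (fun (N : ℕ) (z : Fin k → ℝ) =>
        ∑ m ∈ Fintype.piFinset fun _ : Fin k => Finset.Icc (-(N : ℤ)) N,
          ((∏ n, ((N : ℝ) + 1 - |(m n : ℝ)|) / ((N : ℝ) + 1) : ℝ) : ℂ) *
            mFourierCoeff (fun z => (F z : ℂ)) m *
            Complex.exp (Complex.I * ∑ i, (m i : ℝ) * z i))
      (fun z => (F z : ℂ)) atTop := by
  exact tendstoUniformly_fejerMean (Complex.continuous_ofReal.comp hF)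
    fun z i => congrArg Complex.ofReal (hper z i)
end
end

section
/- Let ν ∈ ℝ^k be nonresonant and let F : ℝ^k → ℝ be continuous and 2π-periodic in each of its k arguments, with Fourier coefficients F_m := (2π)^{−k} ∫_{[0,2π]^k} F(z) e^{−i m·z} dz. Define f(θ) := F(νθ) where νθ := (ν₁θ, …, ν_kθ). Then for every m ∈ ℤ^k the limit lim_{T→∞} (1/T) ∫₀^T f(θ) e^{−i(m·ν)θ} dθ exists and equals F_m; in particular (the case m = 0) the mean lim_{T→∞} (1/T) ∫₀^T f(θ) dθ exists and equals F_0 = (2π)^{−k} ∫_{[0,2π]^k} F(z) dz. -/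
open MeasureTheory Filter
noncomputable section

/-- The trigonometric monomial `z ↦ e^{i n·z}`. -/
def trigMonomial {k : ℕ} (n : Fin k → ℤ) (z : Fin k → ℝ) : ℂ :=
  Complex.exp (Complex.I * zdot n z)

lemma continuous_trigMonomial {k : ℕ} (n : Fin k → ℤ) : Continuous (trigMonomial n) := by
  unfold trigMonomial zdot
  fun_prop

lemma trigMonomial_eq_prod {k : ℕ} (n : Fin k → ℤ) (z : Fin k → ℝ) :
    trigMonomial n z = ∏ i, Complex.exp (Complex.I * n i * z i) := by
  simp only [trigMonomial, zdot, ← Complex.exp_sum]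
  push_cast
  rw [Finset.mul_sum]
  simp only [mul_assoc]

lemma trigMonomial_zero {k : ℕ} : trigMonomial (0 : Fin k → ℤ) = 1 := by
  ext z
  simp [trigMonomial, zdot]

lemma periodic2Pi_trigMonomial {k : ℕ} (n : Fin k → ℤ) : Periodic2Pi (trigMonomial n) := by
  intro z i
  simp only [trigMonomial_eq_prod]
  refine Finset.prod_congr rfl fun j _ => ?_
  rcases eq_or_ne j i with rfl | h
  · rw [Function.update_self, Complex.exp_eq_exp_iff_exists_int]
    exact ⟨n j, by push_cast; ring⟩
  · rw [Function.update_of_ne h]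

lemma Periodic2Pi.map_add_int {k : ℕ} {E : Type*} {F : (Fin k → ℝ) → E} (hF : Periodic2Pi F)
    (n : Fin k → ℤ) (z : Fin k → ℝ) : F (z + fun i => n i * (2 * Real.pi)) = F z := by
  have hsingle (i : Fin k) : Function.Periodic F (Pi.single i (2 * Real.pi)) := by
    intro w
    rw [← hF w i]
    congr 1
    ext j
    rcases eq_or_ne j i with rfl | h <;> simp [*]
  have hsum (s : Finset (Fin k)) :
      Function.Periodic F (∑ i ∈ s, n i • Pi.single i (2 * Real.pi)) := by
    induction s using Finset.induction_on with
    | empty => intro w; simp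
    | insert i s hi ih => rw [Finset.sum_insert hi]; exact ((hsingle i).zsmul (n i)).add_period ih
  convert hsum Finset.univ z using 2
  ext i
  simp [Finset.sum_apply, Pi.single_apply]

/-- Continuous periodic functions are uniform limits of trigonometric polynomials. -/
lemma Periodic2Pi.exists_mem_span_trigMonomial_near {k : ℕ} {G : (Fin k → ℝ) → ℂ}
    (hG : Continuous G) (hper : Periodic2Pi G) {ε : ℝ} (hε : 0 < ε) :
    ∃ P ∈ Submodule.span ℂ (Set.range (trigMonomial (k := k))), ∀ z, ‖G z - P z‖ < ε := by
  have hq : IsOpenQuotientMap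
      (Pi.map fun _ x => (x : UnitAddCircle) : (Fin k → ℝ) → UnitAddTorus (Fin k)) :=
    .piMap fun _ => QuotientAddGroup.isOpenQuotientMap_mk
  let G₁ : C(Fin k → ℝ, ℂ) := ⟨fun x => G fun i => 2 * Real.pi * x i, by fun_prop⟩
  have hG₁ : Function.FactorsThrough G₁
      (Pi.map fun _ x => (x : UnitAddCircle) : (Fin k → ℝ) → UnitAddTorus (Fin k)) := by
    intro x y hxy
    have hex (i : Fin k) : ∃ n : ℤ, x i = y i + n := by
      have h := congr_fun hxy i
      simp only [Pi.map_apply] at h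
      obtain ⟨n, hn⟩ := QuotientAddGroup.eq_iff_sub_mem.1 h
      exact ⟨n, by simp at hn; linarith⟩
    choose n hn using hex
    change G _ = G _
    rw [← hper.map_add_int n (fun i => 2 * Real.pi * y i)]
    congr 1
    ext i
    simp only [hn, Pi.add_apply]
    ring
  let g : C(UnitAddTorus (Fin k), ℂ) :=
    hq.isQuotientMap.lift (f := ⟨_, hq.continuous⟩) G₁ hG₁
  have hg (x : Fin k → ℝ) : g (fun i => (x i : UnitAddCircle)) = G₁ x :=
    DFunLike.congr_fun (hq.isQuotientMap.lift_comp (f := ⟨_, hq.continuous⟩) G₁ hG₁) x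
  have hmem : g ∈ (Submodule.span ℂ (Set.range
      (UnitAddTorus.mFourier (d := Fin k)))).topologicalClosure := by
    rw [UnitAddTorus.span_mFourier_closure_eq_top]
    trivial
  obtain ⟨p, hp, hgp⟩ := Metric.mem_closure_iff.1 hmem ε hε
  let c (z : Fin k → ℝ) : UnitAddTorus (Fin k) :=
    fun i => ((z i / (2 * Real.pi) : ℝ) : UnitAddCircle)
  refine ⟨fun z => p (c z), ?_, fun z => ?_⟩
  · clear hgp
    induction hp using Submodule.span_induction with
    | mem p hp =>
      obtain ⟨n, rfl⟩ := hp
      refine Submodule.subset_span ⟨n, ?_⟩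
      ext z
      rw [trigMonomial_eq_prod]
      refine Finset.prod_congr rfl fun i _ => ?_
      rw [fourier_coe_apply]
      congr 1
      have := Complex.ofReal_ne_zero.2 Real.pi_ne_zero
      push_cast
      field_simp
    | zero => exact Submodule.zero_mem _
    | add p q _ _ hp hq => exact Submodule.add_mem _ hp hq
    | smul a p _ hp => exact Submodule.smul_mem _ a hp
  · have h : G z = g (c z) := by
      rw [hg]
      change G z = G _
      congr 1
      ext i
      have := Real.pi_ne_zero
      field_simp
    rw [h, ← dist_eq_norm]
    exact (ContinuousMap.dist_apply_le_dist _).trans_lt hgp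

/-- The average of `G` over the cube `[0,2π]^k`. -/
def cubeAverage {k : ℕ} (G : (Fin k → ℝ) → ℂ) : ℂ :=
  ((2 * Real.pi) ^ k : ℝ)⁻¹ • ∫ z in Set.Icc (0 : Fin k → ℝ) (fun _ => 2 * Real.pi), G z

/-- The average of `G` over the time interval `[0,T]` along the line `θ ↦ νθ`. -/
def timeAverage {k : ℕ} (ν : Fin k → ℝ) (G : (Fin k → ℝ) → ℂ) (T : ℝ) : ℂ :=
  (1 / (T : ℂ)) * ∫ θ in (0:ℝ)..T, G fun i => ν i * θ

lemma volume_real_cube (k : ℕ) :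
    volume.real (Set.Icc (0 : Fin k → ℝ) (fun _ => 2 * Real.pi)) = (2 * Real.pi) ^ k := by
  rw [measureReal_def, Real.volume_Icc_pi_toReal fun _ => by simpa using Real.pi_pos.le]
  simp

lemma norm_cubeAverage_le {k : ℕ} {G : (Fin k → ℝ) → ℂ} {C : ℝ} (hC : ∀ z, ‖G z‖ ≤ C) :
    ‖cubeAverage G‖ ≤ C := by
  have h := norm_setIntegral_le_of_norm_le_const (μ := volume)
    (isCompact_Icc (a := (0 : Fin k → ℝ)) (b := fun _ => 2 * Real.pi)).measure_lt_top
    fun z _ => hC z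
  rw [volume_real_cube] at h
  have hpos : 0 < (2 * Real.pi) ^ k := by positivity
  rw [cubeAverage, norm_smul, norm_inv, Real.norm_of_nonneg hpos.le, inv_mul_le_iff₀ hpos]
  linarith

lemma norm_timeAverage_le {k : ℕ} (ν : Fin k → ℝ) {G : (Fin k → ℝ) → ℂ} {C : ℝ}
    (hC : ∀ z, ‖G z‖ ≤ C) {T : ℝ} (hT : 0 < T) : ‖timeAverage ν G T‖ ≤ C := by
  have h := intervalIntegral.norm_integral_le_of_norm_le_const (a := 0) (b := T)
    (f := fun θ => G fun i => ν i * θ) fun θ _ => hC _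
  rw [sub_zero, abs_of_pos hT] at h
  rw [timeAverage, norm_mul, norm_div, norm_one, Complex.norm_of_nonneg hT.le, one_div,
    inv_mul_le_iff₀ hT]
  linarith

lemma cubeAverage_add {k : ℕ} {G H : (Fin k → ℝ) → ℂ} (hG : Continuous G) (hH : Continuous H) :
    cubeAverage (G + H) = cubeAverage G + cubeAverage H := by
  simp only [cubeAverage, Pi.add_apply]
  rw [integral_add (hG.continuousOn.integrableOn_compact isCompact_Icc)
    (hH.continuousOn.integrableOn_compact isCompact_Icc), smul_add]

lemma cubeAverage_smul {k : ℕ} (a : ℂ) (G : (Fin k → ℝ) → ℂ) :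
    cubeAverage (a • G) = a • cubeAverage G := by
  simp only [cubeAverage, Pi.smul_apply, integral_smul]
  rw [smul_comm]

lemma timeAverage_add {k : ℕ} (ν : Fin k → ℝ) {G H : (Fin k → ℝ) → ℂ} (hG : Continuous G)
    (hH : Continuous H) (T : ℝ) :
    timeAverage ν (G + H) T = timeAverage ν G T + timeAverage ν H T := by
  simp only [timeAverage, Pi.add_apply]
  rw [intervalIntegral.integral_add, mul_add]
  all_goals exact Continuous.intervalIntegrable (by fun_prop) _ _

lemma timeAverage_smul {k : ℕ} (ν : Fin k → ℝ) (a : ℂ) (G : (Fin k → ℝ) → ℂ) (T : ℝ) :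
    timeAverage ν (a • G) T = a • timeAverage ν G T := by
  simp only [timeAverage, Pi.smul_apply, smul_eq_mul, intervalIntegral.integral_const_mul]
  ring

lemma cubeAverage_one {k : ℕ} : cubeAverage (1 : (Fin k → ℝ) → ℂ) = 1 := by
  have hpos : ((2 * Real.pi) ^ k : ℝ) ≠ 0 := by positivity
  simp only [cubeAverage, Pi.one_apply, setIntegral_const, volume_real_cube]
  rw [inv_smul_smul₀ hpos]

lemma cubeAverage_trigMonomial {k : ℕ} {n : Fin k → ℤ} (hn : n ≠ 0) :
    cubeAverage (trigMonomial n) = 0 := by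
  obtain ⟨i, hi⟩ := Function.ne_iff.1 hn
  have hc : Complex.I * n i ≠ 0 := by simpa using hi
  have hintegral : ∫ x in Set.Icc 0 (2 * Real.pi), Complex.exp (Complex.I * n i * x) = 0 := by
    rw [integral_Icc_eq_integral_Ioc, ← intervalIntegral.integral_of_le (by positivity),
      integral_exp_mul_complex hc]
    have h : Complex.exp (Complex.I * n i * (2 * Real.pi : ℝ)) = 1 :=
      Complex.exp_eq_one_iff.2 ⟨n i, by push_cast; ring⟩
    rw [h]
    simp
  simp only [cubeAverage, trigMonomial_eq_prod]
  rw [← Set.pi_univ_Icc, volume_pi, Measure.restrict_pi_pi,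
    integral_fintype_prod_eq_prod fun i (x : ℝ) => Complex.exp (Complex.I * n i * x),
    Finset.prod_eq_zero (Finset.mem_univ i) hintegral, smul_zero]

lemma tendsto_timeAverage_trigMonomial {k : ℕ} {ν : Fin k → ℝ} (hν : Nonresonant ν)
    (n : Fin k → ℤ) :
    Tendsto (timeAverage ν (trigMonomial n)) atTop (nhds (cubeAverage (trigMonomial n))) := by
  rcases eq_or_ne n 0 with rfl | hn
  · rw [trigMonomial_zero, cubeAverage_one]
    refine tendsto_const_nhds.congr' ?_
    filter_upwards [eventually_ne_atTop 0] with T hT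
    simp [timeAverage, hT]
  rw [cubeAverage_trigMonomial hn]
  have hc : Complex.I * zdot n ν ≠ 0 := by
    simpa using fun h => hn (hν n h)
  have hbound (T : ℝ) :
      ‖(Complex.exp (Complex.I * zdot n ν * T) - 1) / (Complex.I * zdot n ν)‖
        ≤ 2 / ‖Complex.I * zdot n ν‖ := by
    rw [norm_div]
    gcongr
    refine (norm_sub_le _ _).trans ?_
    rw [mul_assoc, ← Complex.ofReal_mul, Complex.norm_exp_I_mul_ofReal]
    norm_num
  have heq : timeAverage ν (trigMonomial n) = fun T : ℝ =>
      (1 / (T : ℂ)) *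
        ((Complex.exp (Complex.I * zdot n ν * T) - 1) / (Complex.I * zdot n ν)) := by
    ext T
    have h (θ : ℝ) : trigMonomial n (fun i => ν i * θ) =
        Complex.exp (Complex.I * zdot n ν * θ) := by
      rw [trigMonomial, mul_assoc, ← Complex.ofReal_mul]
      simp only [zdot, Finset.sum_mul, mul_assoc]
    simp only [timeAverage, h, integral_exp_mul_complex hc]
    simp
  rw [heq]
  refine squeeze_zero_norm' (a := fun T : ℝ => T⁻¹ * (2 / ‖Complex.I * zdot n ν‖)) ?_
    (by simpa using tendsto_inv_atTop_zero.mul_const (2 / ‖Complex.I * zdot n ν‖))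
  filter_upwards [eventually_gt_atTop 0] with T hT
  rw [norm_mul, norm_div, norm_one, Complex.norm_of_nonneg hT.le, one_div]
  gcongr
  exact hbound T

lemma continuous_and_tendsto_timeAverage_of_mem_span {k : ℕ} {ν : Fin k → ℝ}
    (hν : Nonresonant ν) {P : (Fin k → ℝ) → ℂ}
    (hP : P ∈ Submodule.span ℂ (Set.range (trigMonomial (k := k)))) :
    Continuous P ∧ Tendsto (timeAverage ν P) atTop (nhds (cubeAverage P)) := by
  induction hP using Submodule.span_induction with
  | mem P hP =>
    obtain ⟨n, rfl⟩ := hP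
    exact ⟨continuous_trigMonomial n, tendsto_timeAverage_trigMonomial hν n⟩
  | zero => exact ⟨continuous_const, by simp +unfoldPartialApp [timeAverage, cubeAverage]⟩
  | add P Q _ _ hP hQ =>
    refine ⟨hP.1.add hQ.1, ?_⟩
    rw [cubeAverage_add hP.1 hQ.1]
    exact (hP.2.add hQ.2).congr fun T => (timeAverage_add ν hP.1 hQ.1 T).symm
  | smul a P _ hP =>
    refine ⟨hP.1.const_smul a, ?_⟩
    rw [cubeAverage_smul]
    exact (hP.2.const_smul a).congr fun T => (timeAverage_smul ν a P T).symm

/-- Weyl equidistribution of nonresonant linear flows on the torus. -/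
theorem Nonresonant.tendsto_timeAverage {k : ℕ} {ν : Fin k → ℝ} (hν : Nonresonant ν)
    {G : (Fin k → ℝ) → ℂ} (hG : Continuous G) (hper : Periodic2Pi G) :
    Tendsto (timeAverage ν G) atTop (nhds (cubeAverage G)) := by
  rw [Metric.tendsto_nhds]
  intro ε hε
  obtain ⟨P, hP, hGP⟩ := hper.exists_mem_span_trigMonomial_near hG (show 0 < ε / 3 by positivity)
  obtain ⟨hPc, hPt⟩ := continuous_and_tendsto_timeAverage_of_mem_span hν hP
  have hD : ∀ z, ‖(G - P) z‖ ≤ ε / 3 := fun z => (hGP z).le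
  have hDc : Continuous (G - P) := hG.sub hPc
  have hcube : cubeAverage G = cubeAverage (G - P) + cubeAverage P := by
    rw [← cubeAverage_add hDc hPc, sub_add_cancel]
  filter_upwards [eventually_gt_atTop 0,
    Metric.tendsto_nhds.1 hPt (ε / 3) (by positivity)] with T hT hT'
  have htime : timeAverage ν G T = timeAverage ν (G - P) T + timeAverage ν P T := by
    rw [← timeAverage_add ν hDc hPc, sub_add_cancel]
  rw [dist_eq_norm] at hT' ⊢
  calc ‖timeAverage ν G T - cubeAverage G‖
      = ‖timeAverage ν (G - P) T - cubeAverage (G - P)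
          + (timeAverage ν P T - cubeAverage P)‖ := by rw [htime, hcube]; congr 1; ring
    _ ≤ ‖timeAverage ν (G - P) T‖ + ‖cubeAverage (G - P)‖
          + ‖timeAverage ν P T - cubeAverage P‖ :=
        (norm_add_le _ _).trans (by gcongr; exact norm_sub_le _ _)
    _ < ε := by linarith [norm_timeAverage_le ν hD hT, norm_cubeAverage_le hD]

/-- Lemma 4.3c, flow version of Weyl's equidistribution theorem. -/
theorem weyl_time_average {k : ℕ} (ν : Fin k → ℝ) (hν : Nonresonant ν)
    (F : (Fin k → ℝ) → ℝ) (hF : Continuous F) (hper : Periodic2Pi F) :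
    (∀ m : Fin k → ℤ,
      Tendsto (fun T : ℝ => (1 / (T : ℂ)) *
          ∫ θ in (0:ℝ)..T, ((F fun i => ν i * θ : ℝ) : ℂ) *
            Complex.exp (-(Complex.I * (zdot m ν) * θ)))
        atTop (nhds (mFourierCoeff (fun z => (F z : ℂ)) m))) ∧
    Tendsto (fun T : ℝ => (1 / T) * ∫ θ in (0:ℝ)..T, F fun i => ν i * θ)
      atTop (nhds (((2 * Real.pi) ^ k : ℝ)⁻¹ *
        ∫ z in Set.Icc (0 : Fin k → ℝ) (fun _ => 2 * Real.pi), F z)) := by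
  constructor
  · intro m
    have h := hν.tendsto_timeAverage
      (G := fun z => (F z : ℂ) * trigMonomial (-m) z)
      ((Complex.continuous_ofReal.comp hF).mul (continuous_trigMonomial _))
      fun z i => by simp only [hper z i, periodic2Pi_trigMonomial (-m) z i]
    convert h using 2 with T
    · simp only [timeAverage, trigMonomial, zdot]
      congr! 5 with θ
      push_cast
      simp only [Finset.mul_sum, Finset.sum_mul, ← Finset.sum_neg_distrib, Pi.neg_apply]
      refine Finset.sum_congr rfl fun i _ => ?_
      push_cast
      ring
    · simp only [mFourierCoeff, cubeAverage, trigMonomial, zdot]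
      congr! 5 with z
      simp
  · have h := hν.tendsto_timeAverage (G := fun z => (F z : ℂ))
      (Complex.continuous_ofReal.comp hF) fun z i => by simp only [hper z i]
    have hre := (Complex.continuous_re.tendsto _).comp h
    convert hre using 2
    · simp only [Function.comp_apply, timeAverage, intervalIntegral.integral_ofReal]
      norm_cast
    · simp only [cubeAverage, integral_complex_ofReal, Complex.real_smul]
      norm_cast
end
end

section
/- Let d ≥ 1 and n be integers, let F : ℝ^{d+1} → ℝ be of class C^n and 2π-periodic in each of its d+1 arguments with F_0 = 0, where F_m := (2π)^{−(d+1)} ∫_{[0,2π]^{d+1}} F(z) e^{−i m·z} dz are its Fourier coefficients. Let ω ∈ Ω(τ) with 0 < τ < n−d−2. Define, for each natural number N, G_N(z) := Σ_{m ∈ ℤ^{d+1}, 0 < ‖m‖ ≤ N} (−i)(m·(1,ω))^{−1} F_m (e^{i m·z} − 1). Then (G_N) converges uniformly on ℝ^{d+1} to a C¹ function G that is 2π-periodic in each argument and satisfies ∇G(z)·(1,ω) = F(z) for all z ∈ ℝ^{d+1}. -/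
open MeasureTheory Filter
noncomputable section

theorem summable_int_norm_rpow {k : ℕ} {r : ℝ} (hr : r < -k) :
    Summable fun m : Fin k → ℤ => ‖m‖ ^ r := by
  let b := Pi.basisFun ℝ (Fin k)
  let c := b.restrictScalars ℤ
  have hfin : Module.finrank ℤ (Submodule.span ℤ (Set.range b)) = k := by
    simpa using Module.finrank_eq_card_basis c
  have h := ZLattice.summable_norm_rpow (L := Submodule.span ℤ (Set.range b)) r
    (by rw [hfin]; exact hr)
  refine ((c.equivFun.symm.toEquiv.summable_iff).2 h).congr fun m => ?_
  have hm : ((c.equivFun.symm m : Submodule.span ℤ (Set.range b)) : Fin k → ℝ) =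
      fun i => (m i : ℝ) := by
    ext i
    simp [c, b, Module.Basis.equivFun_symm_apply, Finset.sum_apply, Pi.single_apply]
  simp only [Function.comp_apply, LinearEquiv.coe_toEquiv, Submodule.coe_norm, hm]
  congr 1

theorem Periodic2Pi.apply_eq_of_sub_int {k : ℕ} {E : Type*} {F : (Fin k → ℝ) → E}
    (hF : Periodic2Pi F) (z w : Fin k → ℝ) (n : Fin k → ℤ)
    (h : ∀ i, w i = z i + n i * (2 * Real.pi)) : F w = F z := by
  have hsingle (i : Fin k) : Function.Periodic F (Pi.single i (2 * Real.pi)) := fun z => by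
    rw [← hF z i]
    congr 1
    ext j
    rcases eq_or_ne j i with rfl | hj <;> simp [*]
  have hsum (s : Finset (Fin k)) :
      Function.Periodic F (∑ i ∈ s, n i • Pi.single i (2 * Real.pi)) := by
    induction s using Finset.induction_on with
    | empty => intro z; simp
    | insert i s hi ih =>
      rw [Finset.sum_insert hi]
      exact ((hsingle i).zsmul (n i)).add_period ih
  rw [← hsum Finset.univ z]
  congr 1
  ext j
  simp [h, Finset.sum_apply, Pi.single_apply]

theorem Periodic2Pi.exists_torus_lift {k : ℕ} {F : (Fin k → ℝ) → ℂ} (hF : Periodic2Pi F)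
    (hc : Continuous F) : ∃ f : C(UnitAddTorus (Fin k), ℂ),
      ∀ x : Fin k → ℝ, f (fun i => (x i : UnitAddCircle)) = F ((2 * Real.pi) • x) := by
  have hq : IsOpenQuotientMap
      (Pi.map fun _ : Fin k => ((↑) : ℝ → UnitAddCircle)) :=
    IsOpenQuotientMap.piMap fun _ => QuotientAddGroup.isOpenQuotientMap_mk
  let q : C(Fin k → ℝ, UnitAddTorus (Fin k)) := ⟨_, hq.continuous⟩
  let g : C(Fin k → ℝ, ℂ) := ⟨fun x => F ((2 * Real.pi) • x), by fun_prop⟩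
  have hqq : Topology.IsQuotientMap q := hq.isQuotientMap
  have hfac : Function.FactorsThrough g q := fun x y hxy => by
    have (i : Fin k) : ∃ n : ℤ, n • (1 : ℝ) = x i - y i := by
      rw [← AddCircle.coe_eq_zero_iff, AddCircle.coe_sub, sub_eq_zero]
      exact congrFun hxy i
    choose n hn using this
    refine hF.apply_eq_of_sub_int _ _ n fun i => ?_
    have := hn i
    simp only [zsmul_eq_mul, mul_one] at this
    simp only [Pi.smul_apply, smul_eq_mul, this]
    ring
  exact ⟨hqq.lift g hfac, fun x => congrArg (fun h : C(Fin k → ℝ, ℂ) => h x)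
    (hqq.lift_comp g hfac)⟩

theorem mFourier_coe_apply {k : ℕ} (m : Fin k → ℤ) (x : Fin k → ℝ) :
    UnitAddTorus.mFourier m (fun i => (x i : UnitAddCircle)) =
      Complex.exp (Complex.I * ∑ i, (m i : ℝ) * ((2 * Real.pi) • x) i) := by
  simp only [UnitAddTorus.mFourier, ContinuousMap.coe_mk, fourier_coe_apply, Complex.ofReal_sum,
    Finset.mul_sum,
    Complex.exp_sum]
  refine Finset.prod_congr rfl fun i _ => ?_
  congr 1
  push_cast [Pi.smul_apply, smul_eq_mul]
  ring

open scoped Pointwise in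
theorem torus_mFourierCoeff_eq {k : ℕ} {F : (Fin k → ℝ) → ℂ} {f : C(UnitAddTorus (Fin k), ℂ)}
    (hf : ∀ x : Fin k → ℝ, f (fun i => (x i : UnitAddCircle)) = F ((2 * Real.pi) • x))
    (m : Fin k → ℤ) : UnitAddTorus.mFourierCoeff f m = mFourierCoeff F m := by
  have hset : {x : Fin k → ℝ | ∀ i, x i ∈ Set.Ioc ((0 : Fin k → ℝ) i) ((0 : Fin k → ℝ) i + 1)} =
      Set.pi Set.univ fun i => Set.Ioc ((0 : Fin k → ℝ) i) ((1 : Fin k → ℝ) i) := by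
    ext x; simp
  have hsmul : (2 * Real.pi) • Set.Icc (0 : Fin k → ℝ) 1 =
      Set.Icc (0 : Fin k → ℝ) (fun _ => 2 * Real.pi) := by
    ext x
    simp only [Set.mem_smul_set_iff_inv_smul_mem₀ Real.two_pi_pos.ne', Set.mem_Icc, Pi.le_def,
      Pi.smul_apply, Pi.zero_apply, Pi.one_apply, smul_eq_mul,
      inv_mul_le_iff₀ Real.two_pi_pos, mul_one, le_inv_mul_iff₀ Real.two_pi_pos, mul_zero]
  rw [UnitAddTorus.mFourierCoeff_eq_integral f m 0, hset, volume_pi,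
    setIntegral_congr_set Measure.univ_pi_Ioc_ae_eq_Icc, ← volume_pi, mFourierCoeff, ← hsmul]
  have h := Measure.setIntegral_comp_smul_of_pos (volume : Measure (Fin k → ℝ))
    (fun z => F z * Complex.exp (-Complex.I * ∑ i, (m i : ℝ) * z i)) (Set.Icc 0 1)
    Real.two_pi_pos
  rw [Module.finrank_fin_fun] at h
  rw [← h]
  congr 1
  ext x
  rw [mFourier_coe_apply, hf, smul_eq_mul, mul_comm]
  congr 2
  simp

/-- Fourier inversion for continuous periodic functions with summable coefficients. -/
theorem Periodic2Pi.hasSum_mFourierCoeff {k : ℕ} {F : (Fin k → ℝ) → ℂ} (hF : Periodic2Pi F)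
    (hc : Continuous F) (hs : Summable (mFourierCoeff F)) (z : Fin k → ℝ) :
    HasSum (fun m : Fin k → ℤ =>
      mFourierCoeff F m * Complex.exp (Complex.I * ∑ i, (m i : ℝ) * z i)) (F z) := by
  obtain ⟨f, hf⟩ := hF.exists_torus_lift hc
  have hcoeff := torus_mFourierCoeff_eq hf
  have h := UnitAddTorus.hasSum_mFourier_series_apply_of_summable (f := f)
    (by simpa only [funext hcoeff] using hs) (fun i => (((2 * Real.pi)⁻¹ • z) i : ℝ))
  have hz : (2 * Real.pi) • (2 * Real.pi)⁻¹ • z = z := smul_inv_smul₀ Real.two_pi_pos.ne' z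
  simpa only [hf, mFourier_coe_apply, hcoeff, hz, smul_eq_mul] using h

theorem integral_fderiv_single_eq_zero {d : ℕ} {g : (Fin (d + 1) → ℝ) → ℂ} (hg : ContDiff ℝ 1 g)
    (hper : Periodic2Pi g) (j : Fin (d + 1)) :
    ∫ z in Set.Icc (0 : Fin (d + 1) → ℝ) (fun _ => 2 * Real.pi),
      fderiv ℝ g z (Pi.single j 1) = 0 := by
  have hcont : Continuous fun z => fderiv ℝ g z (Pi.single j 1) :=
    (hg.continuous_fderiv one_ne_zero).clm_apply continuous_const
  have hsum (z : Fin (d + 1) → ℝ) :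
      ∑ i, (if i = j then fderiv ℝ g z else 0) (Pi.single i 1) = fderiv ℝ g z (Pi.single j 1) := by
    rw [Finset.sum_eq_single j] <;> simp +contextual
  have h := integral_divergence_of_hasFDerivAt_off_countable' (0 : Fin (d + 1) → ℝ)
    (fun _ => 2 * Real.pi) (fun _ => Real.two_pi_pos.le) (fun i z => if i = j then g z else 0)
    (fun i z => if i = j then fderiv ℝ g z else 0) ∅ Set.countable_empty
    (fun i => by
      split_ifs
      exacts [hg.continuous.continuousOn, continuousOn_const])
    (fun z _ i => by
      split_ifs
      exacts [(hg.differentiable one_ne_zero z).hasFDerivAt, hasFDerivAt_const _ _])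
    (by simpa only [hsum] using hcont.continuousOn.integrableOn_compact isCompact_Icc)
  simp only [hsum] at h
  rw [h]
  refine Finset.sum_eq_zero fun i _ => ?_
  rw [sub_eq_zero]
  congr 1
  ext x
  split_ifs with hi
  · have := hper (i.insertNth 0 x) i
    rw [Fin.insertNth_apply_same, zero_add, Fin.update_insertNth] at this
    exact this
  · rfl

theorem Periodic2Pi.mul {k : ℕ} {F G : (Fin k → ℝ) → ℂ} (hF : Periodic2Pi F)
    (hG : Periodic2Pi G) : Periodic2Pi fun z => F z * G z := fun z i => by
  simp only [hF z i, hG z i]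

theorem periodic2Pi_exp {k : ℕ} (m : Fin k → ℤ) :
    Periodic2Pi fun z : Fin k → ℝ => Complex.exp (Complex.I * ∑ i, (m i : ℝ) * z i) := by
  intro z i
  have : ∑ j, (m j : ℝ) * Function.update z i (z i + 2 * Real.pi) j =
      (∑ j, (m j : ℝ) * z j) + m i * (2 * Real.pi) := by
    rw [← sub_eq_iff_eq_add', ← Finset.sum_sub_distrib, Finset.sum_eq_single i]
    · simp; ring
    · intro j _ hj
      simp [hj]
    · simp
  simp only [this]
  rw [Complex.exp_eq_exp_iff_exists_int]
  exact ⟨m i, by push_cast; ring⟩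

/-- The linear form `v ↦ m · v`, with complex values. -/
def zdotCLM {k : ℕ} (m : Fin k → ℤ) : (Fin k → ℝ) →L[ℝ] ℂ :=
  Complex.ofRealCLM.comp (∑ i, (m i : ℝ) • ContinuousLinearMap.proj i)

theorem zdotCLM_apply {k : ℕ} (m : Fin k → ℤ) (v : Fin k → ℝ) :
    zdotCLM m v = (zdot m v : ℝ) := by
  simp [zdotCLM, zdot]

theorem norm_zdotCLM_le {k : ℕ} (m : Fin k → ℤ) : ‖zdotCLM m‖ ≤ k * ‖m‖ := by
  refine ContinuousLinearMap.opNorm_le_bound _ (by positivity) fun v => ?_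
  rw [zdotCLM_apply, Complex.norm_real, zdot]
  refine (norm_sum_le _ _).trans ?_
  refine (Finset.sum_le_card_nsmul _ _ (‖m‖ * ‖v‖) fun i _ => ?_).trans (by simp [mul_assoc])
  rw [norm_mul]
  gcongr
  · simpa [Int.norm_eq_abs] using norm_le_pi_norm m i
  · exact norm_le_pi_norm v i

theorem hasFDerivAt_exp_zdot {k : ℕ} (m : Fin k → ℤ) (z : Fin k → ℝ) :
    HasFDerivAt (fun z : Fin k → ℝ => Complex.exp (Complex.I * ∑ i, (m i : ℝ) * z i))
      ((Complex.exp (Complex.I * ∑ i, (m i : ℝ) * z i) * Complex.I) • zdotCLM m) z := by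
  have h := (((zdotCLM m).hasFDerivAt (x := z)).const_mul Complex.I).cexp
  simp only [zdotCLM_apply, zdot, smul_smul] at h
  exact h

theorem contDiff_exp_zdot {k : ℕ} (m : Fin k → ℤ) {r : WithTop ℕ∞} :
    ContDiff ℝ r
      fun z : Fin k → ℝ => Complex.exp (Complex.I * ∑ i, (m i : ℝ) * z i) := by
  have h : ContDiff ℝ r fun z => Complex.exp (Complex.I * zdotCLM m z) :=
    (contDiff_const.mul (zdotCLM m).contDiff).cexp
  simpa only [zdotCLM_apply, zdot] using h

theorem mFourierCoeff_eq {k : ℕ} (F : (Fin k → ℝ) → ℂ) (m : Fin k → ℤ) :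
    mFourierCoeff F m = ((2 * Real.pi) ^ k : ℝ)⁻¹ •
      ∫ z in Set.Icc (0 : Fin k → ℝ) (fun _ => 2 * Real.pi),
        F z * Complex.exp (Complex.I * ∑ i, ((-m) i : ℝ) * z i) := by
  simp [mFourierCoeff]

theorem norm_mFourierCoeff_le {k : ℕ} (F : (Fin k → ℝ) → ℂ) (m : Fin k → ℤ) :
    ‖mFourierCoeff F m‖ ≤ ((2 * Real.pi) ^ k : ℝ)⁻¹ *
      ∫ z in Set.Icc (0 : Fin k → ℝ) (fun _ => 2 * Real.pi), ‖F z‖ := by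
  rw [mFourierCoeff_eq, norm_smul, Real.norm_of_nonneg (by positivity)]
  gcongr
  refine (norm_integral_le_integral_norm _).trans_eq ?_
  simp only [norm_mul, mul_comm Complex.I, Complex.norm_exp_ofReal_mul_I, mul_one]

/-- Integration by parts: differentiation acts on Fourier coefficients as multiplication. -/
theorem mFourierCoeff_fderiv_single {d : ℕ} {F : (Fin (d + 1) → ℝ) → ℂ} (hF : ContDiff ℝ 1 F)
    (hper : Periodic2Pi F) (j : Fin (d + 1)) (m : Fin (d + 1) → ℤ) :
    mFourierCoeff (fun z => fderiv ℝ F z (Pi.single j 1)) m =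
      Complex.I * m j * mFourierCoeff F m := by
  have hzero := integral_fderiv_single_eq_zero (hF.mul (contDiff_exp_zdot (-m)))
    (hper.mul (periodic2Pi_exp (-m))) j
  have hderiv (z : Fin (d + 1) → ℝ) :
      fderiv ℝ (fun z => F z * Complex.exp (Complex.I * ∑ i, ((-m) i : ℝ) * z i)) z
        (Pi.single j 1) =
      fderiv ℝ F z (Pi.single j 1) * Complex.exp (Complex.I * ∑ i, ((-m) i : ℝ) * z i) -
        Complex.I * m j * (F z * Complex.exp (Complex.I * ∑ i, ((-m) i : ℝ) * z i)) := by
    rw [((hF.differentiable one_ne_zero z).hasFDerivAt.fun_mul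
      (hasFDerivAt_exp_zdot (-m) z)).fderiv]
    have : zdotCLM (-m) (Pi.single j 1) = -(m j : ℂ) := by
      simp [zdotCLM_apply, zdot, Pi.single_apply]
    simp only [add_apply, smul_apply, this, smul_eq_mul]
    ring
  simp only [hderiv] at hzero
  have hexp := (contDiff_exp_zdot (-m) (r := 1)).continuous
  have hfd : Continuous fun z => fderiv ℝ F z (Pi.single j 1) :=
    (hF.continuous_fderiv one_ne_zero).clm_apply continuous_const
  rw [integral_sub ((hfd.fun_mul hexp).continuousOn.integrableOn_compact isCompact_Icc)
    ((continuous_const.fun_mul (hF.continuous.fun_mul hexp)).continuousOn.integrableOn_compact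
      isCompact_Icc), integral_const_mul, sub_eq_zero] at hzero
  rw [mFourierCoeff_eq, mFourierCoeff_eq, hzero, mul_smul_comm]

theorem Periodic2Pi.fderiv_apply {k : ℕ} {F : (Fin k → ℝ) → ℂ} (hF : Periodic2Pi F)
    (v : Fin k → ℝ) : Periodic2Pi fun z => fderiv ℝ F z v := fun z i => by
  have hupd (w : Fin k → ℝ) :
      Function.update w i (w i + 2 * Real.pi) = w + Pi.single i (2 * Real.pi) := by
    ext j
    rcases eq_or_ne j i with rfl | hj <;> simp [*]
  have h : (fun w => F (w + Pi.single i (2 * Real.pi))) = F := by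
    ext w
    rw [← hupd, hF]
  simp only [hupd]
  rw [← fderiv_comp_add_right, h]

theorem exists_abs_pow_mul_norm_mFourierCoeff_le {d r : ℕ} {F : (Fin (d + 1) → ℝ) → ℂ}
    (hF : ContDiff ℝ r F) (hper : Periodic2Pi F) (j : Fin (d + 1)) :
    ∃ C, ∀ m : Fin (d + 1) → ℤ, ‖m j‖ ^ r * ‖mFourierCoeff F m‖ ≤ C := by
  induction r generalizing F with
  | zero => exact ⟨_, fun m => by simpa using norm_mFourierCoeff_le F m⟩
  | succ r ih =>
    obtain ⟨C, hC⟩ := ih (F := fun z => fderiv ℝ F z (Pi.single j 1))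
      ((hF.fderiv_right (m := r) (by norm_cast)).clm_apply contDiff_const)
      (hper.fderiv_apply _)
    refine ⟨C, fun m => (Eq.le ?_).trans (hC m)⟩
    rw [mFourierCoeff_fderiv_single (hF.of_le (by norm_cast; omega)) hper, norm_mul, norm_mul,
      Complex.norm_I, Complex.norm_intCast, ← Int.norm_eq_abs]
    ring

theorem norm_eq_intNorm {k : ℕ} (m : Fin k → ℤ) : ‖m‖ = intNorm m := by
  rw [Pi.norm_def, intNorm, ← NNReal.coe_natCast, NNReal.coe_inj,
    Finset.apply_sup_eq_sup_comp_of_linearOrder (fun n : ℕ => (n : NNReal)) Nat.mono_cast (by simp)]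
  congr 1
  ext i
  simp [Int.norm_eq_abs, Nat.cast_natAbs]

/-- Fourier coefficients of a `C^r` periodic function decay like `‖m‖^{-r}`. -/
theorem exists_norm_mFourierCoeff_le {d r : ℕ} {F : (Fin (d + 1) → ℝ) → ℂ}
    (hF : ContDiff ℝ r F) (hper : Periodic2Pi F) :
    ∃ C, 0 ≤ C ∧ ∀ m : Fin (d + 1) → ℤ, ‖m‖ ^ r * ‖mFourierCoeff F m‖ ≤ C := by
  choose C hC using exists_abs_pow_mul_norm_mFourierCoeff_le hF hper
  have hC0 (j : Fin (d + 1)) : 0 ≤ C j := le_trans (by positivity) (hC j 0)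
  refine ⟨∑ j, C j, Finset.sum_nonneg fun j _ => hC0 j, fun m => ?_⟩
  obtain ⟨j, -, hj⟩ := Finset.exists_mem_eq_sup Finset.univ Finset.univ_nonempty
    fun i => (m i).natAbs
  have hmj : ‖m‖ = ‖m j‖ := by
    rw [norm_eq_intNorm, intNorm, hj, Int.norm_eq_abs, Nat.cast_natAbs, Int.cast_abs]
  rw [hmj]
  exact (hC j m).trans (Finset.single_le_sum (fun i _ => hC0 i) (Finset.mem_univ j))

/-- A trigonometric series `∑ a_m (e^{i m·z} - 1)` with `∑ ‖a_m‖ ‖m‖ < ∞` defines a `C¹` function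
and may be differentiated termwise. -/
theorem contDiff_tsum_exp_sub_one {k : ℕ} {a : (Fin k → ℤ) → ℂ}
    (ha : Summable fun m => ‖a m‖ * ‖m‖) :
    let G := fun z : Fin k → ℝ =>
      ∑' m, a m * (Complex.exp (Complex.I * ∑ i, (m i : ℝ) * z i) - 1)
    ContDiff ℝ 1 G ∧ ∀ z v, HasSum (fun m => a m * (Complex.I * (zdot m v : ℝ)) *
      Complex.exp (Complex.I * ∑ i, (m i : ℝ) * z i)) (fderiv ℝ G z v) := by
  intro G
  let f' (m : Fin k → ℤ) (z : Fin k → ℝ) : (Fin k → ℝ) →L[ℝ] ℂ :=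
    a m • (Complex.exp (Complex.I * ∑ i, (m i : ℝ) * z i) * Complex.I) • zdotCLM m
  have hf (m : Fin k → ℤ) (z : Fin k → ℝ) :
      HasFDerivAt (fun z : Fin k → ℝ =>
        a m * (Complex.exp (Complex.I * ∑ i, (m i : ℝ) * z i) - 1)) (f' m z) z :=
    ((hasFDerivAt_exp_zdot m z).sub_const 1).const_mul (a m)
  have hbound (m : Fin k → ℤ) (z : Fin k → ℝ) : ‖f' m z‖ ≤ k * (‖a m‖ * ‖m‖) := by
    simp only [f', norm_smul, norm_mul, mul_comm Complex.I, Complex.norm_exp_ofReal_mul_I,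
      Complex.norm_I, one_mul]
    calc ‖a m‖ * ‖zdotCLM m‖ ≤ ‖a m‖ * (k * ‖m‖) := by gcongr; exact norm_zdotCLM_le m
      _ = k * (‖a m‖ * ‖m‖) := by ring
  have hu := ha.mul_left (k : ℝ)
  have hG (z : Fin k → ℝ) : HasFDerivAt G (∑' m, f' m z) z :=
    hasFDerivAt_tsum hu hf hbound (x₀ := 0) (by simp) z
  refine ⟨?_, fun z v => ?_⟩
  · rw [contDiff_one_iff_fderiv]
    refine ⟨fun z => (hG z).differentiableAt, ?_⟩
    rw [show fderiv ℝ G = fun z => ∑' m, f' m z from funext fun z => (hG z).fderiv]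
    refine continuous_tsum (fun m => ?_) hu hbound
    exact (((contDiff_exp_zdot m (r := 1)).continuous.mul continuous_const).smul
      continuous_const).const_smul (a m)
  · rw [(hG z).fderiv]
    have h := (ContinuousLinearMap.apply ℝ ℂ v).hasSum
      (Summable.of_norm_bounded hu fun m => hbound m z).hasSum
    refine h.congr_fun fun m => ?_
    simp only [ContinuousLinearMap.apply_apply, f', smul_apply, smul_eq_mul,
      zdotCLM_apply]
    ring

theorem tendsto_piFinset_Icc_atTop (k : ℕ) :
    Tendsto (fun N : ℕ => Fintype.piFinset fun _ : Fin k => Finset.Icc (-(N : ℤ)) N)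
      atTop atTop := by
  refine tendsto_atTop_finset_of_monotone (fun M N h => ?_) fun m => ⟨intNorm m, ?_⟩
  · exact Fintype.piFinset_subset _ _ fun _ => Finset.Icc_subset_Icc (by omega) (by omega)
  · rw [Fintype.mem_piFinset]
    intro i
    have : (m i).natAbs ≤ intNorm m := Finset.le_sup (f := fun i => (m i).natAbs)
      (Finset.mem_univ i)
    rw [Finset.mem_Icc]
    omega

theorem one_le_norm_of_ne_zero {k : ℕ} {m : Fin k → ℤ} (hm : m ≠ 0) : 1 ≤ ‖m‖ := by
  have := norm_pos_iff.2 hm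
  rw [norm_eq_intNorm] at this ⊢
  exact_mod_cast this


/-- Lemma 4.7, small divisors under a Diophantine condition. -/
theorem small_divisor_lemma (d n : ℕ) (hd : 1 ≤ d) (τ : ℝ)
    (F : (Fin (d + 1) → ℝ) → ℝ) (hF : ContDiff ℝ n F) (hper : Periodic2Pi F)
    (hF0 : mFourierCoeff (fun z => (F z : ℂ)) 0 = 0)
    (ω : Fin d → ℝ) (hω : ω ∈ DiophSet d τ)
    (hτ0 : 0 < τ) (hτ : τ < (n : ℝ) - d - 2) :
    ∃ G : (Fin (d + 1) → ℝ) → ℂ,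
      TendstoUniformly
        (fun (N : ℕ) (z : Fin (d + 1) → ℝ) =>
          ∑ m ∈ (Fintype.piFinset fun _ : Fin (d + 1) => Finset.Icc (-(N : ℤ)) N).erase 0,
            -Complex.I * (((zdot m (oneOmega ω))⁻¹ : ℝ) : ℂ) *
              mFourierCoeff (fun z => (F z : ℂ)) m *
              (Complex.exp (Complex.I * ∑ i, (m i : ℝ) * z i) - 1))
        G atTop ∧
      ContDiff ℝ 1 G ∧ Periodic2Pi G ∧
      ∀ z, fderiv ℝ G z (oneOmega ω) = (F z : ℂ) := by
  obtain ⟨γ, ⟨hγ, -⟩, hdioph⟩ : ∃ γ ∈ Set.Ioc (0 : ℝ) 1, ∀ m : Fin (d + 1) → ℤ, m ≠ 0 →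
      γ * (intNorm m : ℝ) ^ (-τ) ≤ |zdot m (oneOmega ω)| := by
    simpa only [DiophSet, Set.mem_iUnion, exists_prop, Set.mem_ofPred_eq] using hω
  set Fc : (Fin (d + 1) → ℝ) → ℂ := fun z => (F z : ℂ)
  have hFc : ContDiff ℝ n Fc := Complex.ofRealCLM.contDiff.comp hF
  have hperc : Periodic2Pi Fc := fun z i => congrArg Complex.ofReal (hper z i)
  obtain ⟨C, hC0, hC⟩ := exists_norm_mFourierCoeff_le hFc hperc
  set a : (Fin (d + 1) → ℤ) → ℂ := fun m =>
    -Complex.I * (((zdot m (oneOmega ω))⁻¹ : ℝ) : ℂ) * mFourierCoeff Fc m with ha_def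
  have ha0 : a 0 = 0 := by simp [ha_def, hF0]
  have hcoeff (m : Fin (d + 1) → ℤ) : ‖mFourierCoeff Fc m‖ ≤ C * ‖m‖ ^ (-(n : ℝ)) := by
    rcases eq_or_ne m 0 with rfl | hm
    · rw [hF0, norm_zero]
      positivity
    · have hpos := norm_pos_iff.2 hm
      rw [Real.rpow_neg hpos.le, Real.rpow_natCast, ← div_eq_mul_inv, le_div_iff₀ (by positivity),
        mul_comm]
      exact hC m
  have hdiv {m : Fin (d + 1) → ℤ} (hm : m ≠ 0) :
      zdot m (oneOmega ω) ≠ 0 ∧ |(zdot m (oneOmega ω))⁻¹| ≤ γ⁻¹ * ‖m‖ ^ τ := by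
    have hpos := norm_pos_iff.2 hm
    have h := hdioph m hm
    rw [← norm_eq_intNorm] at h
    have hlt : 0 < γ * ‖m‖ ^ (-τ) := by positivity
    refine ⟨abs_pos.1 (hlt.trans_le h), ?_⟩
    rw [abs_inv]
    refine (inv_anti₀ hlt h).trans_eq ?_
    rw [mul_inv, Real.rpow_neg hpos.le, inv_inv]
  have hbound (m : Fin (d + 1) → ℤ) :
      ‖a m‖ * ‖m‖ ≤ γ⁻¹ * C * ‖m‖ ^ (τ + 1 - n) := by
    rcases eq_or_ne m 0 with rfl | hm
    · rw [ha0, norm_zero, zero_mul]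
      positivity
    · have hpos := norm_pos_iff.2 hm
      simp only [ha_def, norm_mul, norm_neg, Complex.norm_I, one_mul, Complex.norm_real,
        Real.norm_eq_abs]
      calc |(zdot m (oneOmega ω))⁻¹| * ‖mFourierCoeff Fc m‖ * ‖m‖
          ≤ γ⁻¹ * ‖m‖ ^ τ * (C * ‖m‖ ^ (-(n : ℝ))) * ‖m‖ := by
            gcongr
            exacts [(hdiv hm).2, hcoeff m]
        _ = γ⁻¹ * C * ‖m‖ ^ (τ + 1 - n) := by
            rw [sub_eq_add_neg, Real.rpow_add hpos, Real.rpow_add hpos, Real.rpow_one]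
            ring
  have hsumm' : Summable fun m => ‖a m‖ * ‖m‖ :=
    Summable.of_nonneg_of_le (fun m => by positivity) hbound
      ((summable_int_norm_rpow (by push_cast; linarith)).mul_left _)
  have hsumm : Summable fun m => ‖a m‖ :=
    Summable.of_nonneg_of_le (fun m => norm_nonneg _) (fun m => by
      rcases eq_or_ne m 0 with rfl | hm
      · simp [ha0]
      · exact le_mul_of_one_le_right (norm_nonneg _) (one_le_norm_of_ne_zero hm)) hsumm'
  obtain ⟨hG1, hGderiv⟩ := contDiff_tsum_exp_sub_one hsumm'
  refine ⟨_, ?_, hG1, ?_, fun z => ?_⟩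
  · have hunif := tendstoUniformly_tsum (hsumm.mul_right 2) (f := fun m (z : Fin (d + 1) → ℝ) =>
      a m * (Complex.exp (Complex.I * ∑ i, (m i : ℝ) * z i) - 1)) fun m z => by
        rw [norm_mul]
        gcongr
        refine (norm_sub_le _ _).trans ?_
        rw [mul_comm Complex.I, Complex.norm_exp_ofReal_mul_I, norm_one]
        norm_num
    intro u hu
    filter_upwards [(tendsto_piFinset_Icc_atTop (d + 1)).eventually (hunif u hu)] with N hN z
    rw [Finset.sum_erase _ (by simp)]
    exact hN z
  · intro z i
    exact tsum_congr fun m => congrArg (fun e => a m * (e - 1)) (periodic2Pi_exp m z i)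
  · refine (hGderiv z (oneOmega ω)).unique ?_
    refine (hperc.hasSum_mFourierCoeff hFc.continuous ?_ z).congr_fun fun m => ?_
    · exact Summable.of_norm_bounded ((summable_int_norm_rpow (by push_cast; linarith)).mul_left C)
        hcoeff
    · congr 1
      rcases eq_or_ne m 0 with rfl | hm
      · rw [ha0, hF0, zero_mul]
      · have hne : (zdot m (oneOmega ω) : ℂ) ≠ 0 := Complex.ofReal_ne_zero.2 (hdiv hm).1
        simp only [ha_def, Complex.ofReal_inv]
        field_simp
        linear_combination (-mFourierCoeff Fc m) * Complex.I_sq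
end
end

section
/- In the spin-orbit setting, assume additionally that 𝒜 is of class C^r and let 0 < τ < r − d − 3. Suppose an invariant frame field 𝒱 of class C^r exists and that ω ∈ Ω(τ). Then a uniform invariant frame field exists: there are a C¹ map 𝒰 : ℝ × ℝ^d → SO(3), 2π-periodic in θ and in each component of φ, and a constant ν ∈ [0,1) with 𝒟𝒰 = 𝒜𝒰 − ν𝒰𝒥. -/
open MeasureTheory Filter
noncomputable section

theorem summable_norm_rpow_int_pi (k : ℕ) (s : ℝ) (hs : s < -k) :
    Summable fun m : Fin k → ℤ => ‖m‖ ^ s := by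
  let b := Pi.basisFun ℝ (Fin k)
  let L := Submodule.span ℤ (Set.range b)
  have hfin : Module.finrank ℤ L = k := by
    rw [Module.finrank_eq_card_basis (b.restrictScalars ℤ), Fintype.card_fin]
  have h := ZLattice.summable_norm_rpow L s (by rw [hfin]; exact hs)
  have hmem : ∀ m : Fin k → ℤ, (fun i => (m i : ℝ)) ∈ L := by
    intro m
    rw [Module.Basis.mem_span_iff_repr_mem ℤ b]
    intro i
    exact ⟨m i, by simp [b]⟩
  have := h.comp_injective (i := fun m => (⟨_, hmem m⟩ : L)) (by
    intro m n hmn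
    ext i
    have : (m i : ℝ) = n i := congrFun (congrArg Subtype.val hmn) i
    exact_mod_cast this)
  exact this.congr fun m => rfl

section Torus

attribute [local instance] instMeasureSpaceUnitAddCircle instIsAddHaarMeasureUnitAddCircleVolume
  instIsProbabilityMeasureUnitAddCircleVolume

open UnitAddTorus (mFourier)

variable {k : ℕ}

/-- The quotient map `ℝ^k → (ℝ/ℤ)^k`. -/
def torusMk (z : Fin k → ℝ) : UnitAddTorus (Fin k) := fun i => (z i : UnitAddCircle)

theorem isOpenQuotientMap_torusMk : IsOpenQuotientMap (torusMk (k := k)) :=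
  IsOpenQuotientMap.piMap fun _ => QuotientAddGroup.isOpenQuotientMap_mk

theorem torusMk_add (z w : Fin k → ℝ) : torusMk (z + w) = torusMk z + torusMk w := rfl

theorem mFourier_apply_add (m : Fin k → ℤ) (x y : UnitAddTorus (Fin k)) :
    mFourier m (x + y) = mFourier m x * mFourier m y := by
  simp only [mFourier, ContinuousMap.coe_mk, ← Finset.prod_mul_distrib]
  refine Finset.prod_congr rfl fun i _ => ?_
  rw [Pi.add_apply, fourier_apply, fourier_apply, fourier_apply, smul_add,
    AddCircle.toCircle_add, Circle.coe_mul]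

theorem mFourier_torusMk (m : Fin k → ℤ) (z : Fin k → ℝ) :
    mFourier m (torusMk z) = Complex.exp (2 * Real.pi * Complex.I * zdot m z) := by
  simp only [mFourier, torusMk, ContinuousMap.coe_mk, fourier_coe_apply, zdot,
    ← Complex.exp_sum]
  congr 1
  push_cast
  rw [Finset.mul_sum]
  refine Finset.sum_congr rfl fun i _ => ?_
  ring

theorem add_intCast_eq_of_periodic {E : Type*} {G : (Fin k → ℝ) → E}
    (hG : ∀ z i, G (z + Pi.single i 1) = G z) (z : Fin k → ℝ) (m : Fin k → ℤ) :
    G (z + fun i => (m i : ℝ)) = G z := by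
  let P : AddSubgroup (Fin k → ℝ) :=
    { carrier := {v | ∀ z, G (z + v) = G z}
      zero_mem' := fun z => by rw [add_zero]
      add_mem' := fun {a b} ha hb z => by rw [← add_assoc, hb, ha]
      neg_mem' := fun {a} ha z => by rw [← ha (z + -a), neg_add_cancel_right] }
  have hm : (fun i => (m i : ℝ)) = ∑ i, m i • (Pi.single i 1 : Fin k → ℝ) := by
    ext j
    simp [Finset.sum_apply, Pi.single_apply]
  have : (fun i => (m i : ℝ)) ∈ P := by
    rw [hm]
    refine sum_mem fun i _ => zsmul_mem ?_ _
    exact fun z => hG z i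
  exact this z

theorem exists_torus_lift {E : Type*} [TopologicalSpace E] {G : (Fin k → ℝ) → E}
    (hc : Continuous G) (hG : ∀ z i, G (z + Pi.single i 1) = G z) :
    ∃ g : C(UnitAddTorus (Fin k), E), ∀ z, g (torusMk z) = G z := by
  have hq := isOpenQuotientMap_torusMk (k := k)
  have hfac : ∀ z w : Fin k → ℝ, torusMk z = torusMk w → G z = G w := by
    intro z w h
    have : ∀ i, ∃ n : ℤ, w i - z i = n := by
      intro i
      have hi : (z i : UnitAddCircle) = w i := congrFun h i
      obtain ⟨n, hn⟩ := QuotientAddGroup.eq_iff_sub_mem.1 hi.symm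
      exact ⟨n, by simpa using hn.symm⟩
    choose n hn using this
    rw [← add_intCast_eq_of_periodic hG z n]
    congr 1
    ext i
    simp [← hn]
  have hcomp : ∀ z, G (Function.surjInv hq.surjective (torusMk z)) = G z := fun z =>
    hfac _ _ (Function.surjInv_eq hq.surjective _)
  refine ⟨⟨fun x => G (Function.surjInv hq.surjective x), ?_⟩, hcomp⟩
  rw [← hq.continuous_comp_iff]
  exact hc.congr fun z => (hcomp z).symm

theorem mFourierCoeff_of_hasDerivAt (g g' : C(UnitAddTorus (Fin k), ℂ)) (i : Fin k)
    (h : ∀ x, HasDerivAt (fun t : ℝ => g (x + torusMk (Pi.single i t))) (g' x) 0)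
    (m : Fin k → ℤ) :
    UnitAddTorus.mFourierCoeff g' m =
      2 * Real.pi * Complex.I * m i * UnitAddTorus.mFourierCoeff g m := by
  have hint : ∀ f : C(UnitAddTorus (Fin k), ℂ), Integrable f := fun f =>
    f.continuous.integrable_of_hasCompactSupport (HasCompactSupport.of_compactSpace _)
  have hsingle : ∀ s t : ℝ, torusMk (Pi.single i (s + t) : Fin k → ℝ) =
      torusMk (Pi.single i s) + torusMk (Pi.single i t) := fun s t => by
    rw [← torusMk_add, ← Pi.single_add]
  have hderiv : ∀ x (t : ℝ), HasDerivAt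
      (fun t : ℝ => mFourier (-m) x • g (x + torusMk (Pi.single i t)))
      (mFourier (-m) x • g' (x + torusMk (Pi.single i t))) t := by
    intro x t
    have h1 := h (x + torusMk (Pi.single i t))
    have h2 : HasDerivAt (fun s : ℝ => g (x + torusMk (Pi.single i s)))
        (g' (x + torusMk (Pi.single i t))) t := by
      have h3 := HasDerivAt.comp_sub_const (x := t) (a := t) (by rw [sub_self]; exact h1)
      refine h3.congr_of_eventuallyEq (Eventually.of_forall fun s => ?_)
      dsimp only
      rw [add_assoc, ← hsingle, add_sub_cancel]
    simp only [smul_eq_mul]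
    exact h2.const_mul _
  have hcont : ∀ (f : C(UnitAddTorus (Fin k), ℂ)) (y : UnitAddTorus (Fin k)),
      Continuous fun x => mFourier (-m) x • f (x + y) := fun f y => by fun_prop
  have hint' : ∀ (f : C(UnitAddTorus (Fin k), ℂ)) (y : UnitAddTorus (Fin k)),
      Integrable fun x => mFourier (-m) x • f (x + y) := fun f y =>
    hint ⟨_, hcont f y⟩
  have key := (hasDerivAt_integral_of_dominated_loc_of_deriv_le (μ := volume)
    (F := fun (t : ℝ) x => mFourier (-m) x • g (x + torusMk (Pi.single i t)))
    (F' := fun (t : ℝ) x => mFourier (-m) x • g' (x + torusMk (Pi.single i t)))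
    (x₀ := 0) (s := Set.univ) (bound := fun _ => ‖g'‖) Filter.univ_mem
    (Eventually.of_forall fun t => (hcont g _).aestronglyMeasurable)
    (hint' g _) (hcont g' _).aestronglyMeasurable
    (Eventually.of_forall fun x t _ => by
      rw [norm_smul]
      calc _ ≤ 1 * ‖g'‖ := by
            gcongr
            · exact (ContinuousMap.norm_coe_le_norm _ _).trans UnitAddTorus.mFourier_norm.le
            · exact ContinuousMap.norm_coe_le_norm _ _
        _ = _ := one_mul _)
    (integrable_const _)
    (Eventually.of_forall fun x t _ => hderiv x t)).2
  have htrans : ∀ t : ℝ, ∫ x, mFourier (-m) x • g (x + torusMk (Pi.single i t)) =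
      Complex.exp (2 * Real.pi * Complex.I * m i * t) * UnitAddTorus.mFourierCoeff g m := by
    intro t
    set y : UnitAddTorus (Fin k) := torusMk (Pi.single i t) with hy
    have hexp : mFourier (-m) (-y) = Complex.exp (2 * Real.pi * Complex.I * m i * t) := by
      have : -y = torusMk (-(Pi.single i t : Fin k → ℝ)) := rfl
      rw [this, mFourier_torusMk]
      congr 1
      have : zdot (-m) (-(Pi.single i t : Fin k → ℝ)) = m i * t := by
        simp [zdot, Pi.single_apply]
      rw [this]
      push_cast
      ring
    rw [← hexp, UnitAddTorus.mFourierCoeff, ← integral_const_mul,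
      ← integral_add_right_eq_self (fun x => mFourier (-m) (-y) * (mFourier (-m) x • g x)) y]
    refine integral_congr_ae (Eventually.of_forall fun x => ?_)
    dsimp only
    have : mFourier (-m) x = mFourier (-m) (-y) * mFourier (-m) (x + y) := by
      rw [← mFourier_apply_add]
      congr 1
      abel
    rw [this, smul_eq_mul, smul_eq_mul, mul_assoc]
  have hz : torusMk (Pi.single i (0 : ℝ)) = (0 : UnitAddTorus (Fin k)) := by
    rw [Pi.single_zero]; rfl
  simp only [htrans, hz, add_zero] at key
  have key2 : HasDerivAt (fun t : ℝ => Complex.exp (2 * Real.pi * Complex.I * m i * t) *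
      UnitAddTorus.mFourierCoeff g m)
      (2 * Real.pi * Complex.I * m i * UnitAddTorus.mFourierCoeff g m) 0 := by
    have h0 : HasDerivAt (fun t : ℝ => 2 * Real.pi * Complex.I * m i * (t : ℂ))
        (2 * Real.pi * Complex.I * m i) 0 := by
      simpa using (Complex.ofRealCLM.hasDerivAt (x := (0 : ℝ))).const_mul
        (2 * Real.pi * Complex.I * m i : ℂ)
    simpa using h0.cexp.mul_const (UnitAddTorus.mFourierCoeff g m)
  exact key.unique key2

theorem exists_pow_mul_norm_mFourierCoeff_le (i : Fin k) (n : ℕ) :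
    ∀ {G : (Fin k → ℝ) → ℂ}, ContDiff ℝ n G → (∀ z j, G (z + Pi.single j 1) = G z) →
    ∀ g : C(UnitAddTorus (Fin k), ℂ), (∀ z, g (torusMk z) = G z) →
    ∃ C : ℝ, ∀ m, ‖m i‖ ^ n * ‖UnitAddTorus.mFourierCoeff g m‖ ≤ C := by
  induction n with
  | zero =>
    intro G _ _ g _
    refine ⟨∫ x, ‖g x‖, fun m => ?_⟩
    rw [pow_zero, one_mul]
    refine (norm_integral_le_integral_norm _).trans (integral_mono_of_nonneg
      (Eventually.of_forall fun _ => norm_nonneg _)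
      (g.continuous.norm.integrable_of_hasCompactSupport (HasCompactSupport.of_compactSpace _))
      (Eventually.of_forall fun x => ?_))
    dsimp only
    rw [norm_smul]
    exact mul_le_of_le_one_left (norm_nonneg _)
      ((ContinuousMap.norm_coe_le_norm _ _).trans UnitAddTorus.mFourier_norm.le)
  | succ n ih =>
    intro G hG hper g hg
    have hG' : ContDiff ℝ n fun z => fderiv ℝ G z (Pi.single i 1) :=
      (hG.fderiv_right (m := n) (by norm_cast)).clm_apply contDiff_const
    have hper' : ∀ z j, fderiv ℝ G (z + Pi.single j 1) (Pi.single i 1) =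
        fderiv ℝ G z (Pi.single i 1) := by
      intro z j
      rw [← fderiv_comp_add_right]
      simp only [hper]
    obtain ⟨g', hg'⟩ := exists_torus_lift hG'.continuous hper'
    obtain ⟨C, hC⟩ := ih hG' hper' g' hg'
    have hcoeff := mFourierCoeff_of_hasDerivAt g g' i (fun x => by
      obtain ⟨z, rfl⟩ := isOpenQuotientMap_torusMk.surjective x
      simp only [← torusMk_add, hg, hg']
      have h1 : HasFDerivAt G (fderiv ℝ G z) z :=
        (hG.differentiable (by simp)).differentiableAt.hasFDerivAt
      have h2 : HasDerivAt (fun t : ℝ => z + Pi.single i t) (Pi.single i 1) 0 := by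
        have : HasDerivAt (fun t : ℝ => (Pi.single i t : Fin k → ℝ)) (Pi.single i 1) 0 :=
          (ContinuousLinearMap.single ℝ (fun _ : Fin k => ℝ) i).hasDerivAt
        exact this.const_add z
      have h3 : HasFDerivAt G (fderiv ℝ G z) (z + Pi.single i 0) := by simpa using h1
      exact h3.comp_hasDerivAt (0 : ℝ) h2)
    refine ⟨C, fun m => le_trans ?_ (hC m)⟩
    rw [hcoeff, pow_succ, mul_assoc]
    gcongr
    rw [norm_mul]
    gcongr
    have : ‖(2 * Real.pi * Complex.I * m i : ℂ)‖ = 2 * Real.pi * ‖m i‖ := by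
      simp [abs_of_pos Real.pi_pos, Int.norm_eq_abs]
    rw [this]
    nlinarith [Real.pi_gt_three, norm_nonneg (m i)]

theorem exists_fourier_decay {n : ℕ} {G : (Fin k → ℝ) → ℂ} (hG : ContDiff ℝ n G)
    (hper : ∀ z j, G (z + Pi.single j 1) = G z)
    (g : C(UnitAddTorus (Fin k), ℂ)) (hg : ∀ z, g (torusMk z) = G z) :
    ∃ C : ℝ, ∀ m ≠ 0, ‖m‖ ^ n * ‖UnitAddTorus.mFourierCoeff g m‖ ≤ C := by
  choose C hC using fun i => exists_pow_mul_norm_mFourierCoeff_le i n hG hper g hg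
  refine ⟨∑ i, |C i|, fun m hm => ?_⟩
  have : Nonempty (Fin k) := by
    by_contra h
    rw [not_nonempty_iff] at h
    exact hm (Subsingleton.elim _ _)
  obtain ⟨i, hi⟩ := Finite.exists_max fun i => ‖m i‖
  have hmi : ‖m‖ ≤ ‖m i‖ := (pi_norm_le_iff_of_nonneg (norm_nonneg _)).2 hi
  refine (mul_le_mul_of_nonneg_right (pow_le_pow_left₀ (norm_nonneg _) hmi n)
    (norm_nonneg _)).trans ?_
  exact (hC i m).trans ((le_abs_self _).trans
    (Finset.single_le_sum (f := fun i => |C i|) (fun _ _ => abs_nonneg _) (Finset.mem_univ i)))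

end Torus

theorem exists_periodic_solution_of_diophantine {k n : ℕ} {v : Fin k → ℝ} {γ τ : ℝ} (hγ : 0 < γ)
    (hv : ∀ m : Fin k → ℤ, m ≠ 0 → γ * ‖m‖ ^ (-τ) ≤ |zdot m v|)
    (hn : τ + 1 + k < n) {G : (Fin k → ℝ) → ℂ} (hG : ContDiff ℝ n G)
    (hper : ∀ z j, G (z + Pi.single j 1) = G z) :
    ∃ (c : ℂ) (H : (Fin k → ℝ) → ℂ), ContDiff ℝ 1 H ∧
      (∀ z j, H (z + Pi.single j 1) = H z) ∧ ∀ z, fderiv ℝ H z v = G z - c := by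
  obtain ⟨g, hg⟩ := exists_torus_lift hG.continuous hper
  obtain ⟨C, hC⟩ := exists_fourier_decay hG hper g hg
  set a : (Fin k → ℤ) → ℂ := UnitAddTorus.mFourierCoeff g with ha
  let e : (Fin k → ℤ) → (Fin k → ℝ) → ℂ :=
    fun m z => Complex.exp (2 * Real.pi * Complex.I * zdot m z)
  have he_norm : ∀ m z, ‖e m z‖ = 1 := fun m z => by
    have : (2 * Real.pi * Complex.I * zdot m z : ℂ) =
        ((2 * Real.pi * zdot m z : ℝ) : ℂ) * Complex.I := by push_cast; ring
    simp only [e, this, Complex.norm_exp_ofReal_mul_I]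
  let c : (Fin k → ℤ) → ℂ := fun m => a m / (2 * Real.pi * Complex.I * zdot m v)
  have hnorm1 : ∀ m : Fin k → ℤ, m ≠ 0 → 1 ≤ ‖m‖ := by
    intro m hm
    obtain ⟨i, hi⟩ := Function.ne_iff.1 hm
    refine le_trans ?_ (norm_le_pi_norm m i)
    rw [Int.norm_eq_abs]
    exact_mod_cast Int.one_le_abs hi
  have hc0 : c 0 = 0 := by simp [c, zdot]
  let u : (Fin k → ℤ) → ℝ := fun m => ‖c m‖ * ‖m‖
  have hdne : ∀ m : Fin k → ℤ, m ≠ 0 → (2 * Real.pi * Complex.I * zdot m v : ℂ) ≠ 0 := by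
    intro m hm
    have h1 : 0 < |zdot m v| := lt_of_lt_of_le
      (mul_pos hγ (Real.rpow_pos_of_pos (zero_lt_one.trans_le (hnorm1 m hm)) _)) (hv m hm)
    simpa [Complex.I_ne_zero, Real.pi_ne_zero] using abs_pos.1 h1
  have hu : Summable u := by
    refine Summable.of_nonneg_of_le (fun m => by positivity) (fun m => ?_)
      ((summable_norm_rpow_int_pi k (τ + 1 - n) (by linarith)).mul_left (|C| / γ))
    rcases eq_or_ne m 0 with rfl | hm
    · simp only [u, hc0, norm_zero, zero_mul]
      positivity
    have hpos : 0 < ‖m‖ := zero_lt_one.trans_le (hnorm1 m hm)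
    have hz : 0 < γ * ‖m‖ ^ (-τ) := mul_pos hγ (Real.rpow_pos_of_pos hpos _)
    have hden : γ * ‖m‖ ^ (-τ) ≤ ‖(2 * Real.pi * Complex.I * zdot m v : ℂ)‖ := by
      have : ‖(2 * Real.pi * Complex.I * zdot m v : ℂ)‖ = 2 * Real.pi * |zdot m v| := by
        simp [abs_of_pos Real.pi_pos]
      rw [this]
      nlinarith [hv m hm, Real.pi_gt_three]
    have ha_le : ‖a m‖ ≤ |C| * ‖m‖ ^ (-(n : ℝ)) := by
      rw [Real.rpow_neg hpos.le, Real.rpow_natCast, ← div_eq_mul_inv, le_div_iff₀' (by positivity)]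
      exact (hC m hm).trans (le_abs_self C)
    calc u m = ‖a m‖ / ‖(2 * Real.pi * Complex.I * zdot m v : ℂ)‖ * ‖m‖ := by
          simp only [u, c, norm_div]
      _ ≤ (|C| * ‖m‖ ^ (-(n : ℝ))) / (γ * ‖m‖ ^ (-τ)) * ‖m‖ := by gcongr
      _ = |C| / γ * ‖m‖ ^ (τ + 1 - n) := by
          rw [show τ + 1 - (n : ℝ) = -(n : ℝ) + τ + 1 by ring, Real.rpow_add hpos,
            Real.rpow_add hpos, Real.rpow_one, Real.rpow_neg hpos.le τ]
          field_simp
  let L : (Fin k → ℤ) → (Fin k → ℝ) →L[ℝ] ℝ :=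
    fun m => ∑ i, (m i : ℝ) • ContinuousLinearMap.proj i
  have hL : ∀ m z, L m z = zdot m z := fun m z => by
    simp [L, zdot]
  have hL_norm : ∀ m, ‖L m‖ ≤ k * ‖m‖ := by
    intro m
    refine ContinuousLinearMap.opNorm_le_bound _ (by positivity) fun z => ?_
    rw [hL, zdot]
    calc ‖∑ i, (m i : ℝ) * z i‖ ≤ ∑ _i : Fin k, ‖m‖ * ‖z‖ := by
          refine norm_sum_le_of_le _ fun i _ => ?_
          rw [norm_mul]
          exact mul_le_mul (norm_le_pi_norm m i) (norm_le_pi_norm z i) (norm_nonneg _)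
            (norm_nonneg _)
      _ = k * ‖m‖ * ‖z‖ := by simp [mul_assoc]
  let f' : (Fin k → ℤ) → (Fin k → ℝ) → (Fin k → ℝ) →L[ℝ] ℂ := fun m z =>
    (c m * (2 * Real.pi * Complex.I * e m z)) • (Complex.ofRealCLM.comp (L m))
  have hf : ∀ m z, HasFDerivAt (fun z => c m * e m z) (f' m z) z := by
    intro m z
    have h1 : HasFDerivAt (fun z => (zdot m z : ℂ)) (Complex.ofRealCLM.comp (L m)) z := by
      refine (Complex.ofRealCLM.comp (L m)).hasFDerivAt.congr_of_eventuallyEq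
        (Eventually.of_forall fun z => ?_)
      simp [hL]
    refine ((h1.const_mul (2 * Real.pi * Complex.I : ℂ)).cexp.const_mul (c m)).congr_fderiv ?_
    simp only [f', e, smul_smul]
    congr 1
    ring
  have hf'_norm : ∀ m z, ‖f' m z‖ ≤ 2 * Real.pi * k * u m := by
    intro m z
    have h1 : ‖Complex.ofRealCLM.comp (L m)‖ ≤ k * ‖m‖ := by
      refine ContinuousLinearMap.opNorm_le_bound _ (by positivity) fun w => ?_
      simpa using (L m).le_of_opNorm_le (hL_norm m) w
    have h2 : ‖c m * (2 * Real.pi * Complex.I * e m z)‖ = ‖c m‖ * (2 * Real.pi) := by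
      simp [he_norm, abs_of_pos Real.pi_pos]
    calc ‖f' m z‖ ≤ ‖c m‖ * (2 * Real.pi) * (k * ‖m‖) := by
          simp only [f', norm_smul, h2]
          gcongr
      _ = _ := by simp only [u]; ring
  have hu' := hu.mul_left (2 * Real.pi * k)
  have hf0 : Summable fun m => c m * e m 0 := by
    refine Summable.of_norm_bounded hu fun m => ?_
    rw [norm_mul, he_norm, mul_one]
    rcases eq_or_ne m 0 with rfl | hm
    · simp [u, hc0]
    · exact le_mul_of_one_le_right (norm_nonneg _) (hnorm1 m hm)
  have hderiv : ∀ z, HasFDerivAt (fun z => ∑' m, c m * e m z) (∑' m, f' m z) z := fun z =>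
    hasFDerivAt_tsum hu' hf hf'_norm hf0 z
  have hf'v : ∀ m z, f' m z v = Function.update a 0 0 m * e m z := by
    intro m z
    simp only [f', smul_apply, ContinuousLinearMap.comp_apply, hL,
      Complex.ofRealCLM_apply, smul_eq_mul]
    rcases eq_or_ne m 0 with rfl | hm
    · simp [hc0]
    · rw [Function.update_of_ne hm]
      have : c m * (2 * Real.pi * Complex.I * zdot m v) = a m := div_mul_cancel₀ _ (hdne m hm)
      rw [← this]
      ring
  have hf'_sum : ∀ z, Summable fun m => f' m z := fun z =>
    Summable.of_norm_bounded hu' fun m => hf'_norm m z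
  have ha_sum : Summable a := by
    refine Summable.of_norm_bounded_eventually (hu'.mul_right ‖v‖) ?_
    filter_upwards [(Set.finite_singleton (0 : Fin k → ℤ)).compl_mem_cofinite] with m hm
    have h1 := (f' m 0).le_of_opNorm_le (hf'_norm m 0) v
    rw [hf'v, Function.update_of_ne hm, norm_mul, he_norm, mul_one] at h1
    exact h1
  have hfourier : ∀ z, HasSum (fun m => a m * e m z) (G z) := by
    intro z
    have := UnitAddTorus.hasSum_mFourier_series_apply_of_summable ha_sum (torusMk z)
    simpa only [hg, mFourier_torusMk, smul_eq_mul] using this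
  refine ⟨a 0, fun z => ∑' m, c m * e m z, ?_, ?_, ?_⟩
  · rw [contDiff_one_iff_hasFDerivAt]
    refine ⟨fun z => ∑' m, f' m z, continuous_tsum (fun m => ?_) hu' hf'_norm, hderiv⟩
    have hez : Continuous (e m) := by
      simp only [e, zdot]
      fun_prop
    fun_prop
  · intro z j
    refine tsum_congr fun m => ?_
    simp only [e]
    rw [← mFourier_torusMk, ← mFourier_torusMk, torusMk_add]
    have : torusMk (Pi.single j (1 : ℝ)) = (0 : UnitAddTorus (Fin k)) := by
      ext i
      rcases eq_or_ne i j with rfl | hij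
      · simp [torusMk]
      · simp [torusMk, hij]
    rw [this, add_zero]
  · intro z
    rw [(hderiv z).fderiv]
    have h1 : HasSum (fun m => f' m z v) ((∑' m, f' m z) v) := by
      simpa only [ContinuousLinearMap.apply_apply] using
        (ContinuousLinearMap.apply ℝ ℂ v).hasSum (hf'_sum z).hasSum
    have h2 := (hfourier z).update 0 0
    have h0 : e 0 z = 1 := by simp [e, zdot]
    have h3 : (fun m => f' m z v) = Function.update (fun m => a m * e m z) 0 0 := by
      ext m
      rw [hf'v]
      rcases eq_or_ne m 0 with rfl | hm
      · rw [Function.update_self, Function.update_self, zero_mul]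
      · rw [Function.update_of_ne hm, Function.update_of_ne hm]
    rw [h3] at h1
    rw [h1.unique h2, h0]
    ring

theorem exists_periodicPt_solution {d n : ℕ} {ω : Fin d → ℝ} {τ : ℝ} (hω : ω ∈ DiophSet d τ)
    (hn : τ + d + 2 < n) {f : Pt d → ℝ} (hf : ContDiff ℝ n f) (hper : PeriodicPt f) :
    ∃ (c : ℝ) (h : Pt d → ℝ), ContDiff ℝ 1 h ∧ PeriodicPt h ∧
      ∀ p, fderiv ℝ h p (1, ω) = f p - c := by
  simp only [DiophSet, Set.mem_iUnion, Set.mem_ofPred_eq] at hω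
  obtain ⟨γ, hγ, hdio⟩ := hω
  let T : Pt d ≃L[ℝ] (Fin (d + 1) → ℝ) := Fin.consEquivL ℝ (fun _ => ℝ)
  have hT : ∀ p : Pt d, T p = Fin.cons p.1 p.2 := fun p => rfl
  have hT0 : ∀ (p : Pt d) (s : ℝ), T (p.1 + s, p.2) = T p + Pi.single 0 s := by
    intro p s
    rw [hT, hT]
    ext i
    refine Fin.cases ?_ (fun i => ?_) i <;> simp
  have hTsucc : ∀ (p : Pt d) (i : Fin d) (s : ℝ),
      T (p.1, Function.update p.2 i (p.2 i + s)) = T p + Pi.single i.succ s := by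
    intro p i s
    rw [hT, hT]
    ext j
    refine Fin.cases ?_ (fun j => ?_) j
    · simp
    · rcases eq_or_ne j i with rfl | hj
      · simp
      · simp [hj]
  have hπ : (2 * Real.pi) ≠ 0 := by positivity
  obtain ⟨c, H, hH, hHper, hHv⟩ := exists_periodic_solution_of_diophantine
    (n := n) (v := oneOmega ω) (τ := τ) hγ.1
    (fun m hm => by rw [norm_eq_intNorm]; exact hdio m hm) (by push_cast; linarith)
    (G := fun z => (f (T.symm ((2 * Real.pi) • z)) : ℂ))
    (Complex.ofRealCLM.contDiff.comp (hf.comp (T.symm.contDiff.comp (contDiff_const_smul _))))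
    (by
      intro z j
      obtain ⟨p, hp⟩ := T.surjective ((2 * Real.pi) • z)
      have hs : (2 * Real.pi) • (Pi.single j 1 : Fin (d + 1) → ℝ) =
          Pi.single j (2 * Real.pi) := by
        rw [← Pi.single_smul, smul_eq_mul, mul_one]
      rw [smul_add, hs, ← hp]
      congr 1
      revert j
      refine Fin.cases (fun _ => ?_) (fun i _ => ?_)
      · rw [← hT0, T.symm_apply_apply, T.symm_apply_apply, hper.1]
      · rw [← hTsucc, T.symm_apply_apply, T.symm_apply_apply, hper.2])
  let S : Pt d →L[ℝ] (Fin (d + 1) → ℝ) := (2 * Real.pi)⁻¹ • (T : Pt d →L[ℝ] (Fin (d + 1) → ℝ))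
  have hS : ∀ p, S p = (2 * Real.pi)⁻¹ • T p := fun p => rfl
  have hs : ∀ j, (2 * Real.pi)⁻¹ • (Pi.single j (2 * Real.pi) : Fin (d + 1) → ℝ) =
      Pi.single j 1 := by
    intro j
    rw [← Pi.single_smul, smul_eq_mul, inv_mul_cancel₀ hπ]
  refine ⟨c.re, fun p => 2 * Real.pi * (H (S p)).re, ?_, ⟨fun p => ?_, fun p i => ?_⟩,
    fun p => ?_⟩
  · exact contDiff_const.mul (Complex.reCLM.contDiff.comp (hH.comp S.contDiff))
  · dsimp only
    rw [hS, hS, hT0, smul_add, hs, hHper]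
  · dsimp only
    rw [hS, hS, hTsucc, smul_add, hs, hHper]
  · have h1 : HasFDerivAt H (fderiv ℝ H (S p)) (S p) :=
      (hH.differentiable one_ne_zero).differentiableAt.hasFDerivAt
    have h2 := (Complex.reCLM.hasFDerivAt.comp p (h1.comp p S.hasFDerivAt)).const_mul
      (2 * Real.pi)
    have h3 : HasFDerivAt (fun p => 2 * Real.pi * (H (S p)).re) _ p := h2
    rw [h3.fderiv]
    have h4 : S (1, ω) = (2 * Real.pi)⁻¹ • oneOmega ω := rfl
    simp only [smul_apply, ContinuousLinearMap.comp_apply, h4, map_smul, hHv, smul_eq_mul]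
    rw [mul_inv_cancel_left₀ hπ]
    have h5 : (2 * Real.pi) • T.symm (S p) = p := by
      rw [hS, map_smul, smul_smul, mul_inv_cancel₀ hπ, one_smul, T.symm_apply_apply]
    rw [h5, Complex.reCLM_apply, Complex.sub_re, Complex.ofReal_re]

theorem fderiv_periodicPt {d : ℕ} {f : Pt d → ℝ} (hf : PeriodicPt f) (v : Pt d) :
    PeriodicPt fun p => fderiv ℝ f p v := by
  constructor
  · intro p
    have h : ∀ q : Pt d, f (q + (2 * Real.pi, 0)) = f q := fun q => by
      rw [← hf.1 q]; simp [Prod.add_def]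
    have : (p.1 + 2 * Real.pi, p.2) = p + (2 * Real.pi, 0) := by simp [Prod.add_def]
    simp only [this]
    rw [← fderiv_comp_add_right]
    simp only [h]
  · intro p i
    have hu : ∀ q : Pt d, (q.1, Function.update q.2 i (q.2 i + 2 * Real.pi)) =
        q + (0, Pi.single i (2 * Real.pi)) := by
      intro q
      refine Prod.ext (by simp) ?_
      ext j
      rcases eq_or_ne j i with rfl | hj
      · simp
      · simp [hj]
    simp only [hu]
    rw [← fderiv_comp_add_right]
    simp only [← hu, hf.2]

/-- The rate at which a frame field `V` turns about its third column. -/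
def frameRate {d : ℕ} (ω : Fin d → ℝ) (𝒜 V : Pt d → Matrix (Fin 3) (Fin 3) ℝ) (p : Pt d) : ℝ :=
  ((V p).transpose * (𝒜 p * V p - Dmat ω V p)) 1 0

theorem Dmat_transpose_mul_add {d : ℕ} {ω : Fin d → ℝ} {V : Pt d → Matrix (Fin 3) (Fin 3) ℝ}
    (hs : SmoothMat 1 V) (hSO : ∀ p, V p ∈ SO3) (p : Pt d) :
    (Dmat ω V p).transpose * V p + (V p).transpose * Dmat ω V p = 0 := by
  ext a b
  have hd : ∀ i j, HasFDerivAt (fun q => V q i j) (fderiv ℝ (fun q => V q i j) p) p := fun i j =>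
    ((hs i j).differentiable (by simp)).differentiableAt.hasFDerivAt
  have h1 : HasFDerivAt (fun q => ∑ j, V q j a * V q j b) _ p :=
    HasFDerivAt.fun_sum fun j _ => (hd j a).mul (hd j b)
  have h2 : (fun q => ∑ j, V q j a * V q j b) = fun _ => (1 : Matrix (Fin 3) (Fin 3) ℝ) a b := by
    ext q
    rw [← (hSO q).1]
    rfl
  rw [h2] at h1
  have h3 := DFunLike.congr_fun (h1.unique (hasFDerivAt_const _ _)) (1, ω)
  simp only [sum_apply, add_apply, smul_apply, smul_eq_mul, zero_apply,
    Finset.sum_add_distrib] at h3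
  simp only [Matrix.add_apply, Matrix.mul_apply, Matrix.transpose_apply, Dmat, Matrix.of_apply,
    Matrix.zero_apply]
  rw [← h3, add_comm]
  simp only [mul_comm]

theorem IsIFF.Dmat_eq {d : ℕ} {ω : Fin d → ℝ} {𝒜 V : Pt d → Matrix (Fin 3) (Fin 3) ℝ}
    (hskew : ∀ p, (𝒜 p).transpose = -(𝒜 p)) (hV : IsIFF ω 𝒜 V) (p : Pt d) :
    Dmat ω V p = 𝒜 p * V p - frameRate ω 𝒜 V p • (V p * Jmat) := by
  obtain ⟨hs, -, hSO, hcol⟩ := hV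
  set B := (V p).transpose * (𝒜 p * V p - Dmat ω V p) with hB
  have hBskew : B.transpose = -B := by
    have h := Dmat_transpose_mul_add (ω := ω) hs hSO p
    rw [hB, Matrix.transpose_mul, Matrix.transpose_sub, Matrix.transpose_mul,
      Matrix.transpose_transpose, hskew, Matrix.sub_mul, eq_neg_of_add_eq_zero_left h]
    simp only [Matrix.mul_neg, Matrix.neg_mul, Matrix.mul_sub, Matrix.mul_assoc]
    abel
  have hB2 : ∀ i, B i 2 = 0 := by
    intro i
    rw [hB, Matrix.mul_apply]
    refine Finset.sum_eq_zero fun j _ => ?_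
    have : (𝒜 p * V p - Dmat ω V p) j 2 = 0 := by
      rw [Matrix.sub_apply, sub_eq_zero]
      exact (hcol p j).symm
    rw [this, mul_zero]
  have hentry : ∀ i j, B j i = -B i j := fun i j => congrFun (congrFun hBskew i) j
  have hBJ : B = frameRate ω 𝒜 V p • Jmat := by
    have h10 : frameRate ω 𝒜 V p = B 1 0 := rfl
    rw [h10]
    ext i j
    have h00 := hentry 0 0
    have h11 := hentry 1 1
    have h01 := hentry 1 0
    have h20 := hentry 0 2
    have h21 := hentry 1 2
    rw [hB2, neg_zero] at h20 h21
    fin_cases i <;> fin_cases j <;> simp [Jmat, hB2, h01, h20, h21] <;> linarith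
  have hVV : V p * (V p).transpose = 1 := mul_eq_one_comm.1 (hSO p).1
  have hVB : V p * B = 𝒜 p * V p - Dmat ω V p := by
    rw [hB, ← Matrix.mul_assoc, hVV, Matrix.one_mul]
  rw [hBJ, Matrix.mul_smul] at hVB
  rw [hVB, sub_sub_cancel]

/-- The rotation by the angle `t` about the third axis. -/
def rotZ (t : ℝ) : Matrix (Fin 3) (Fin 3) ℝ :=
  !![Real.cos t, -Real.sin t, 0; Real.sin t, Real.cos t, 0; 0, 0, 1]

theorem rotZ_mem_SO3 (t : ℝ) : rotZ t ∈ SO3 := by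
  have h := Real.sin_sq_add_cos_sq t
  constructor
  · ext i j
    fin_cases i <;> fin_cases j <;>
      simp [rotZ, Matrix.mul_apply, Fin.sum_univ_three] <;> linarith
  · simp [rotZ, Matrix.det_fin_three]
    linarith

theorem mul_mem_SO3 {R S : Matrix (Fin 3) (Fin 3) ℝ} (hR : R ∈ SO3) (hS : S ∈ SO3) :
    R * S ∈ SO3 := by
  refine ⟨?_, by rw [Matrix.det_mul, hR.2, hS.2, one_mul]⟩
  rw [Matrix.transpose_mul, Matrix.mul_assoc, ← Matrix.mul_assoc R.transpose, hR.1,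
    Matrix.one_mul, hS.1]

theorem contDiff_rotZ (i j : Fin 3) {n : WithTop ℕ∞} : ContDiff ℝ n fun t => rotZ t i j := by
  fin_cases i <;> fin_cases j <;> simp [rotZ] <;>
    first
      | exact contDiff_const
      | exact Real.contDiff_cos
      | exact Real.contDiff_sin
      | exact Real.contDiff_sin.neg

theorem hasDerivAt_rotZ (i j : Fin 3) (t : ℝ) :
    HasDerivAt (fun t => rotZ t i j) ((rotZ t * Jmat) i j) t := by
  fin_cases i <;> fin_cases j <;>
    simp [rotZ, Jmat, Matrix.mul_apply, Fin.sum_univ_three, hasDerivAt_const] <;>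
    first
      | exact Real.hasDerivAt_cos t
      | exact Real.hasDerivAt_sin t
      | exact (Real.hasDerivAt_sin t).neg

theorem rotZ_mul_Jmat (t : ℝ) : rotZ t * Jmat = Jmat * rotZ t := by
  ext i j
  fin_cases i <;> fin_cases j <;> simp [rotZ, Jmat, Matrix.mul_apply, Fin.sum_univ_three]

theorem rotZ_add_int_mul_two_pi (t : ℝ) (n : ℤ) : rotZ (t + n * (2 * Real.pi)) = rotZ t := by
  simp [rotZ]

theorem Dmat_mul_rotZ {d : ℕ} {ω : Fin d → ℝ} {V : Pt d → Matrix (Fin 3) (Fin 3) ℝ}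
    {g : Pt d → ℝ} {p : Pt d} (hV : ∀ i j, DifferentiableAt ℝ (fun q => V q i j) p)
    (hg : DifferentiableAt ℝ g p) :
    Dmat ω (fun q => V q * rotZ (g q)) p =
      Dmat ω V p * rotZ (g p) + fderiv ℝ g p (1, ω) • (V p * rotZ (g p) * Jmat) := by
  ext i j
  have h1 : HasFDerivAt (fun q => ∑ l, V q i l * rotZ (g q) l j) _ p :=
    HasFDerivAt.fun_sum fun l _ => (hV i l).hasFDerivAt.mul
      ((hasDerivAt_rotZ l j (g p)).comp_hasFDerivAt p hg.hasFDerivAt)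
  have h2 : (fun q => (V q * rotZ (g q)) i j) = fun q => ∑ l, V q i l * rotZ (g q) l j := rfl
  rw [Dmat, Matrix.of_apply, h2, h1.fderiv, Matrix.mul_assoc, Matrix.add_apply, Matrix.smul_apply,
    Matrix.mul_apply, Matrix.mul_apply, smul_eq_mul, Finset.mul_sum, ← Finset.sum_add_distrib,
    sum_apply]
  refine Finset.sum_congr rfl fun l _ => ?_
  simp only [add_apply, smul_apply, smul_eq_mul, Dmat, Matrix.of_apply]
  ring

theorem contDiff_frameRate {d n : ℕ} {ω : Fin d → ℝ} {𝒜 V : Pt d → Matrix (Fin 3) (Fin 3) ℝ}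
    (h𝒜 : SmoothMat n 𝒜) (hV : SmoothMat (n + 1 : ℕ) V) : ContDiff ℝ n (frameRate ω 𝒜 V) := by
  have hV' : SmoothMat n V := fun i j => (hV i j).of_le (by norm_cast; omega)
  have hD : ∀ i j, ContDiff ℝ n fun p => Dmat ω V p i j := fun i j =>
    ((hV i j).fderiv_right (m := n) (by norm_cast)).clm_apply contDiff_const
  have : frameRate ω 𝒜 V = fun p =>
      ∑ j, V p j 1 * (∑ l, 𝒜 p j l * V p l 0 - Dmat ω V p j 0) := rfl
  rw [this]
  exact ContDiff.sum fun j _ => (hV' j 1).mul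
    ((ContDiff.sum fun l _ => (h𝒜 j l).mul (hV' l 0)).sub (hD j 0))

theorem periodicPt_frameRate {d : ℕ} {ω : Fin d → ℝ} {𝒜 V : Pt d → Matrix (Fin 3) (Fin 3) ℝ}
    (h𝒜 : PeriodicPt 𝒜) (hV : PeriodicPt V) : PeriodicPt (frameRate ω 𝒜 V) := by
  have hD : ∀ i j, PeriodicPt fun p => Dmat ω V p i j := fun i j =>
    fderiv_periodicPt ⟨fun p => by rw [hV.1], fun p l => by rw [hV.2]⟩ _
  constructor
  · intro p
    have : Dmat ω V (p.1 + 2 * Real.pi, p.2) = Dmat ω V p := by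
      ext i j; exact (hD i j).1 p
    simp only [frameRate, h𝒜.1, hV.1, this]
  · intro p l
    have : Dmat ω V (p.1, Function.update p.2 l (p.2 l + 2 * Real.pi)) = Dmat ω V p := by
      ext i j; exact (hD i j).2 p l
    simp only [frameRate, h𝒜.2, hV.2, this]

/-- Theorem 6.5c. -/
theorem IFF_dioph_gives_uniform_IFF {d : ℕ} (hd : 1 ≤ d) (ω : Fin d → ℝ)
    (r : ℕ) (τ : ℝ) (hτ0 : 0 < τ) (hτ : τ < (r : ℝ) - d - 3)
    (𝒜 : Pt d → Matrix (Fin 3) (Fin 3) ℝ)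
    (h𝒜s : SmoothMat 1 𝒜) (h𝒜r : SmoothMat r 𝒜)
    (h𝒜skew : ∀ p, (𝒜 p).transpose = -(𝒜 p)) (h𝒜per : PeriodicPt 𝒜)
    (𝒱 : Pt d → Matrix (Fin 3) (Fin 3) ℝ)
    (h𝒱 : IsIFF ω 𝒜 𝒱) (h𝒱r : SmoothMat r 𝒱)
    (hω : ω ∈ DiophSet d τ) :
    ∃ (𝒰 : Pt d → Matrix (Fin 3) (Fin 3) ℝ) (ν : ℝ), IsUniformIFF ω 𝒜 𝒰 ν := by
  have hr : d + 4 ≤ r := by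
    have : ((d + 3 : ℕ) : ℝ) < r := by push_cast; linarith
    exact_mod_cast this
  obtain ⟨n, rfl⟩ : ∃ n, r = n + 1 := ⟨r - 1, by omega⟩
  have h𝒜n : SmoothMat n 𝒜 := fun i j => (h𝒜r i j).of_le (by norm_cast; omega)
  obtain ⟨c, h, hh, hhper, hhD⟩ := exists_periodicPt_solution (n := n) hω
    (by push_cast at hτ; linarith) (contDiff_frameRate (ω := ω) h𝒜n h𝒱r)
    (periodicPt_frameRate h𝒜per h𝒱.2.1)
  let g : Pt d → ℝ := fun p => h p + ⌊c⌋ * p.1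
  have hg : ContDiff ℝ 1 g := hh.add (contDiff_const.mul contDiff_fst)
  have hgD : ∀ p, fderiv ℝ g p (1, ω) = frameRate ω 𝒜 𝒱 p - Int.fract c := by
    intro p
    have h1 : HasFDerivAt g _ p :=
      (hh.differentiable one_ne_zero p).hasFDerivAt.add (hasFDerivAt_fst.const_mul (⌊c⌋ : ℝ))
    rw [h1.fderiv, add_apply, hhD, smul_apply, ContinuousLinearMap.coe_fst', smul_eq_mul, mul_one,
      ← Int.self_sub_floor]
    ring
  refine ⟨fun p => 𝒱 p * rotZ (g p), Int.fract c, ?_, ⟨fun p => ?_, fun p i => ?_⟩, fun p => ?_,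
    ⟨Int.fract_nonneg c, Int.fract_lt_one c⟩, fun p => ?_⟩
  · intro i j
    simp only [Matrix.mul_apply]
    exact ContDiff.sum fun l _ => (h𝒱.1 i l).mul ((contDiff_rotZ l j).comp hg)
  · have : g (p.1 + 2 * Real.pi, p.2) = g p + ⌊c⌋ * (2 * Real.pi) := by
      simp only [g, hhper.1]
      ring
    simp only [h𝒱.2.1.1, this, rotZ_add_int_mul_two_pi]
  · simp only [g, h𝒱.2.1.2, hhper.2]
  · exact mul_mem_SO3 (h𝒱.2.2.1 p) (rotZ_mem_SO3 _)
  · rw [Dmat_mul_rotZ (fun i j => (h𝒱.1 i j).differentiable (by simp) p)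
      (hg.differentiable one_ne_zero p), IsIFF.Dmat_eq h𝒜skew h𝒱, hgD, Matrix.sub_mul,
      Matrix.smul_mul, sub_smul, Matrix.mul_assoc (𝒱 p) Jmat, ← rotZ_mul_Jmat,
      Matrix.mul_assoc (𝒜 p), Matrix.mul_assoc (𝒱 p) (rotZ _)]
    abel
end
end

section
/- In the spin-orbit setting, let 𝒱 be a uniform invariant frame field with constant precession rate ν = C_𝒱 ∈ [0,1). Then for every φ₀ ∈ ℝ^d and every λ ∈ ℝ with λ ∉ {εν + m·(1,ω) : ε ∈ {−1,0,1}, m ∈ ℤ^{d+1}}, the entrywise limit a(Φ(·;φ₀), λ) := lim_{T→∞} (1/T) ∫₀^T Φ(θ;φ₀) e^{−iλθ} dθ exists and equals the zero matrix; that is, the spectrum Λ(Φ(·;φ₀)) is contained in {εν + m·(1,ω) : ε ∈ {−1,0,1}, m ∈ ℤ^{d+1}}. -/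
open MeasureTheory Filter
noncomputable section

/-- The time average `(1/T) ∫₀^T f` tends to zero as `T → ∞`. -/
def HasZeroMean (f : ℝ → ℂ) : Prop :=
  Tendsto (fun T : ℝ => (1 / (T : ℂ)) * ∫ θ in (0:ℝ)..T, f θ) atTop (nhds 0)

namespace HasZeroMean

theorem zero : HasZeroMean fun _ => 0 := by
  simp [HasZeroMean]

theorem const_mul {f : ℝ → ℂ} (hf : HasZeroMean f) (c : ℂ) : HasZeroMean fun θ => c * f θ := by
  have h := Tendsto.const_mul c hf
  rw [mul_zero] at h
  refine h.congr fun T => ?_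
  rw [intervalIntegral.integral_const_mul]
  ring

theorem add {f g : ℝ → ℂ} (hf : HasZeroMean f) (hg : HasZeroMean g) (hfc : Continuous f)
    (hgc : Continuous g) : HasZeroMean fun θ => f θ + g θ := by
  have h := Tendsto.add hf hg
  rw [add_zero] at h
  refine h.congr fun T => ?_
  rw [intervalIntegral.integral_add (hfc.intervalIntegrable _ _) (hgc.intervalIntegrable _ _)]
  ring

theorem exp_mul {c : ℝ} (hc : c ≠ 0) : HasZeroMean fun θ => Complex.exp (Complex.I * c * θ) := by
  have hc' : Complex.I * c ≠ 0 := mul_ne_zero Complex.I_ne_zero (Complex.ofReal_ne_zero.2 hc)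
  have hlim : Tendsto (fun T : ℝ => 2 / |c| * T⁻¹) atTop (nhds 0) := by
    simpa using tendsto_inv_atTop_zero.const_mul (2 / |c|)
  refine squeeze_zero_norm' ?_ hlim
  filter_upwards [eventually_gt_atTop 0] with T hT
  have hexp : ∀ t : ℝ, ‖Complex.exp (Complex.I * c * t)‖ = 1 := fun t => by
    rw [show Complex.I * c * t = ((c * t : ℝ) : ℂ) * Complex.I by push_cast; ring]
    exact Complex.norm_exp_ofReal_mul_I _
  rw [integral_exp_mul_complex hc', norm_mul, norm_div, norm_div, norm_mul, Complex.norm_I,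
    Complex.norm_real, Complex.norm_real, norm_one, one_mul, Real.norm_eq_abs, Real.norm_eq_abs,
    abs_of_pos hT]
  have hsub : ‖Complex.exp (Complex.I * c * T) - Complex.exp (Complex.I * c * (0 : ℝ))‖ ≤ 2 := by
    refine (norm_sub_le _ _).trans ?_
    rw [hexp, hexp]
    norm_num
  calc 1 / T * (_ / |c|) ≤ 1 / T * (2 / |c|) := by gcongr
    _ = 2 / |c| * T⁻¹ := by ring

theorem of_uniform_approx {f : ℝ → ℂ} (hf : Continuous f)
    (h : ∀ r > 0, ∃ g : ℝ → ℂ, Continuous g ∧ HasZeroMean g ∧ ∀ θ, ‖f θ - g θ‖ ≤ r) :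
    HasZeroMean f := by
  refine Metric.tendsto_nhds.2 fun r hr => ?_
  obtain ⟨g, hgc, hg, hfg⟩ := h (r / 2) (half_pos hr)
  filter_upwards [Metric.tendsto_nhds.1 hg (r / 2) (half_pos hr), eventually_gt_atTop 0]
    with T hgT hT
  rw [dist_zero_right] at hgT ⊢
  have hsplit : (1 / (T : ℂ)) * ∫ θ in (0:ℝ)..T, f θ =
      (1 / (T : ℂ)) * (∫ θ in (0:ℝ)..T, (f θ - g θ)) + (1 / (T : ℂ)) * ∫ θ in (0:ℝ)..T, g θ := by
    rw [intervalIntegral.integral_sub (hf.intervalIntegrable _ _) (hgc.intervalIntegrable _ _)]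
    ring
  have hbound : ‖(1 / (T : ℂ)) * ∫ θ in (0:ℝ)..T, (f θ - g θ)‖ ≤ r / 2 := by
    have hint := intervalIntegral.norm_integral_le_of_norm_le_const
      (a := (0 : ℝ)) (b := T) fun θ _ => hfg θ
    rw [sub_zero, abs_of_pos hT] at hint
    rw [norm_mul, norm_div, norm_one, Complex.norm_real, Real.norm_eq_abs, abs_of_pos hT]
    calc 1 / T * _ ≤ 1 / T * (r / 2 * T) := by gcongr
      _ = r / 2 := by field_simp
  rw [hsplit]
  calc _ ≤ _ := norm_add_le _ _
    _ < r / 2 + r / 2 := add_lt_add_of_le_of_lt hbound hgT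
    _ = r := add_halves r

end HasZeroMean

/-- The image in the torus of the line `θ ↦ vθ + b` in `(ℝ/2πℤ)^k`. -/
def torusLine {k : ℕ} (v b : Fin k → ℝ) (θ : ℝ) : UnitAddTorus (Fin k) :=
  fun i => (((v i * θ + b i) / (2 * Real.pi) : ℝ) : UnitAddCircle)

theorem continuous_torusLine {k : ℕ} (v b : Fin k → ℝ) : Continuous (torusLine v b) :=
  continuous_pi fun i => (AddCircle.continuous_mk' (1 : ℝ)).comp (by fun_prop)

theorem mFourier_torusLine {k : ℕ} (m : Fin k → ℤ) (v b : Fin k → ℝ) (θ : ℝ) :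
    UnitAddTorus.mFourier m (torusLine v b θ) =
      Complex.exp (Complex.I * zdot m b) * Complex.exp (Complex.I * zdot m v * θ) := by
  simp only [UnitAddTorus.mFourier, ContinuousMap.coe_mk, torusLine, fourier_coe_apply]
  rw [← Complex.exp_sum, ← Complex.exp_add]
  congr 1
  simp only [zdot, Complex.ofReal_sum, Finset.mul_sum, Finset.sum_mul, ← Finset.sum_add_distrib]
  refine Finset.sum_congr rfl fun i _ => ?_
  have hpi : (Real.pi : ℂ) ≠ 0 := Complex.ofReal_ne_zero.2 Real.pi_ne_zero
  push_cast
  field_simp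
  ring

/-- The mean of `f(vθ + b) e^{-iμθ}` vanishes for continuous `f` on the torus if `μ` is not an
integer combination of the frequencies `v`. -/
theorem hasZeroMean_torusLine {k : ℕ} (v b : Fin k → ℝ) {μ : ℝ}
    (hμ : ∀ m : Fin k → ℤ, μ ≠ zdot m v) (f : C(UnitAddTorus (Fin k), ℂ)) :
    HasZeroMean fun θ => f (torusLine v b θ) * Complex.exp (-(Complex.I * μ * θ)) := by
  have hcont : ∀ g : C(UnitAddTorus (Fin k), ℂ),
      Continuous fun θ : ℝ => g (torusLine v b θ) * Complex.exp (-(Complex.I * μ * θ)) := fun g =>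
    (g.continuous.comp (continuous_torusLine v b)).mul (by fun_prop)
  have hspan : ∀ g ∈ Submodule.span ℂ (Set.range (UnitAddTorus.mFourier (d := Fin k))),
      HasZeroMean fun θ => g (torusLine v b θ) * Complex.exp (-(Complex.I * μ * θ)) := by
    intro g hg
    induction hg using Submodule.span_induction with
    | mem g hg =>
      obtain ⟨m, rfl⟩ := hg
      have h := (HasZeroMean.exp_mul (sub_ne_zero.2 (hμ m).symm)).const_mul
        (Complex.exp (Complex.I * zdot m b))
      convert h using 2 with θ
      rw [mFourier_torusLine, mul_assoc, ← Complex.exp_add]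
      congr 2
      push_cast
      ring
    | zero => simpa using HasZeroMean.zero
    | add g₁ g₂ _ _ h₁ h₂ =>
      simpa [add_mul] using h₁.add h₂ (hcont g₁) (hcont g₂)
    | smul c g _ h => simpa [mul_assoc] using h.const_mul c
  refine HasZeroMean.of_uniform_approx (hcont f) fun r hr => ?_
  have hf : f ∈ (Submodule.span ℂ (Set.range
      (UnitAddTorus.mFourier (d := Fin k)))).topologicalClosure := by
    rw [UnitAddTorus.span_mFourier_closure_eq_top]
    trivial
  obtain ⟨g, hg, hfg⟩ := Metric.mem_closure_iff.1 hf r hr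
  refine ⟨_, hcont g, hspan g hg, fun θ => ?_⟩
  have hexp : ‖Complex.exp (-(Complex.I * μ * θ))‖ = 1 := by
    rw [show -(Complex.I * μ * θ) = ((-(μ * θ) : ℝ) : ℂ) * Complex.I by push_cast; ring]
    exact Complex.norm_exp_ofReal_mul_I _
  rw [← sub_mul, norm_mul, hexp, mul_one, ← dist_eq_norm]
  exact (ContinuousMap.dist_apply_le_dist _).trans hfg.le

/-- A function with period `2π` in each argument is invariant under translation by `2πℤ^k`. -/
theorem Periodic2Pi.add_int {k : ℕ} {E : Type*} {F : (Fin k → ℝ) → E} (hF : Periodic2Pi F)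
    (n : Fin k → ℤ) (z : Fin k → ℝ) : F (z + fun i => 2 * Real.pi * n i) = F z := by
  let S : AddSubgroup (Fin k → ℝ) :=
    { carrier := {c | ∀ z, F (z + c) = F z}
      zero_mem' := fun z => by rw [add_zero]
      add_mem' := fun {a b} ha hb z => by rw [← add_assoc, hb, ha]
      neg_mem' := fun {a} ha z => by rw [← ha (z + -a), neg_add_cancel_right] }
  have hsingle : ∀ i, Pi.single i (2 * Real.pi) ∈ S := fun i z => by
    rw [← hF z i]
    congr 1
    ext j
    rcases eq_or_ne j i with rfl | hj <;> simp [*]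
  have hsum : ∑ i, n i • Pi.single i (2 * Real.pi) ∈ S :=
    sum_mem fun i _ => S.zsmul_mem (hsingle i) _
  convert hsum z using 3
  ext j
  simp [Finset.sum_apply, Pi.single_apply, mul_comm]

/-- A continuous function with period `2π` in each argument descends to the torus. -/
theorem Periodic2Pi.exists_torus {k : ℕ} {F : (Fin k → ℝ) → ℂ} (hF : Periodic2Pi F)
    (hFc : Continuous F) :
    ∃ f : C(UnitAddTorus (Fin k), ℂ), ∀ v b θ,
      f (torusLine v b θ) = F fun i => v i * θ + b i := by
  let q : C(Fin k → ℝ, UnitAddTorus (Fin k)) :=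
    ⟨Pi.map fun _ x => (x : UnitAddCircle),
      continuous_pi fun i => (AddCircle.continuous_mk' (1 : ℝ)).comp (continuous_apply i)⟩
  have hq : Topology.IsQuotientMap q :=
    (IsOpenQuotientMap.piMap fun _ => QuotientAddGroup.isOpenQuotientMap_mk).isQuotientMap
  let G : C(Fin k → ℝ, ℂ) := ⟨fun x => F fun i => 2 * Real.pi * x i, hFc.comp (by fun_prop)⟩
  have hG : Function.FactorsThrough G q := by
    intro x y hxy
    have hint : ∀ i, ∃ n : ℤ, x i = y i + n := fun i => by
      have hi : (x i : UnitAddCircle) = y i := congrFun hxy i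
      obtain ⟨n, hn⟩ := AddCircle.coe_eq_zero_iff (p := (1 : ℝ)) |>.1
        (show ((x i - y i : ℝ) : UnitAddCircle) = 0 by rw [AddCircle.coe_sub, hi, sub_self])
      rw [zsmul_one] at hn
      exact ⟨n, by linarith⟩
    choose n hn using hint
    change F _ = F _
    rw [← hF.add_int n fun i => 2 * Real.pi * y i]
    congr 1
    ext i
    simp [hn, mul_add]
  refine ⟨hq.lift G hG, fun v b θ => ?_⟩
  have hline : torusLine v b θ = q fun i => (v i * θ + b i) / (2 * Real.pi) := rfl
  rw [hline, ← ContinuousMap.comp_apply, hq.lift_comp]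
  change F _ = F _
  congr 1
  ext i
  field_simp

theorem Periodic2Pi.hasZeroMean {k : ℕ} {F : (Fin k → ℝ) → ℂ} (hF : Periodic2Pi F)
    (hFc : Continuous F) (v b : Fin k → ℝ) {μ : ℝ} (hμ : ∀ m : Fin k → ℤ, μ ≠ zdot m v) :
    HasZeroMean fun θ => F (fun i => v i * θ + b i) * Complex.exp (-(Complex.I * μ * θ)) := by
  obtain ⟨f, hf⟩ := hF.exists_torus hFc
  simpa only [hf] using hasZeroMean_torusLine v b hμ f

/-- The mean of `f(θ, ωθ + φ₀) e^{-iμθ}` vanishes for continuous `2π`-periodic `f` if `μ` is not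
of the form `m·(1,ω)`. -/
theorem PeriodicPt.hasZeroMean {d : ℕ} {f : Pt d → ℂ} (hf : PeriodicPt f) (hfc : Continuous f)
    (ω φ₀ : Fin d → ℝ) {μ : ℝ} (hμ : ∀ m : Fin (d + 1) → ℤ, μ ≠ zdot m (oneOmega ω)) :
    HasZeroMean fun θ =>
      f (θ, fun l => ω l * θ + φ₀ l) * Complex.exp (-(Complex.I * μ * θ)) := by
  have hper : Periodic2Pi fun z : Fin (d + 1) → ℝ => f (z 0, fun l => z l.succ) := by
    intro z i
    refine Fin.cases ?_ (fun l => ?_) i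
    · simpa using hf.1 (z 0, fun l => z l.succ)
    · refine Eq.trans ?_ (hf.2 (z 0, fun l => z l.succ) l)
      refine congrArg f (Prod.ext (by simp [Function.update_of_ne (Fin.succ_ne_zero l).symm]) ?_)
      ext j
      rcases eq_or_ne j l with rfl | hj <;> simp [*]
  simpa [oneOmega] using
    hper.hasZeroMean (hfc.comp (by fun_prop)) (oneOmega ω) (Fin.cons 0 φ₀) hμ

theorem eq_mul_exp_of_hasDerivAt {f : ℝ → ℂ} {c : ℂ} (hf : ∀ t, HasDerivAt f (c * f t) t) (t : ℝ) :
    f t = f 0 * Complex.exp (c * t) := by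
  have hexp : ∀ s : ℝ, HasDerivAt (fun s : ℝ => Complex.exp (-(c * s)))
      (Complex.exp (-(c * s)) * -(c * 1)) s := fun s =>
    ((Complex.ofRealCLM.hasDerivAt (x := s)).const_mul c).neg.cexp
  have hderiv : ∀ s : ℝ, HasDerivAt (fun s : ℝ => f s * Complex.exp (-(c * s))) 0 s := fun s => by
    refine ((hf s).mul (hexp s)).congr_deriv ?_
    ring
  have hconst := is_const_of_deriv_eq_zero (fun s => (hderiv s).differentiableAt)
    (fun s => (hderiv s).deriv) t 0
  simp only [Complex.ofReal_zero, mul_zero, neg_zero, Complex.exp_zero, mul_one] at hconst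
  rw [← hconst, mul_assoc, ← Complex.exp_add, neg_add_cancel, Complex.exp_zero, mul_one]

/-- Along a spin-orbit trajectory, the principal solution expressed in the frame of a uniform
invariant frame field precesses uniformly at rate `ν`. -/
theorem IsUniformIFF.hasDerivAt_transpose_mul {d : ℕ} {ω : Fin d → ℝ}
    {𝒜 𝒱 : Pt d → Matrix (Fin 3) (Fin 3) ℝ} {ν : ℝ} (h𝒱 : IsUniformIFF ω 𝒜 𝒱 ν)
    (h𝒜skew : ∀ p, (𝒜 p).transpose = -(𝒜 p)) {φ₀ : Fin d → ℝ}
    {Φ : ℝ → Matrix (Fin 3) (Fin 3) ℝ} (hΦ : IsPrincipalSolution ω 𝒜 φ₀ Φ) (θ : ℝ) (k j : Fin 3) :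
    HasDerivAt (fun t => ((𝒱 (t, fun l => ω l * t + φ₀ l)).transpose * Φ t) k j)
      ((ν • (Jmat * ((𝒱 (θ, fun l => ω l * θ + φ₀ l)).transpose * Φ θ))) k j) θ := by
  set p : Pt d := (θ, fun l => ω l * θ + φ₀ l)
  have hcurve : HasDerivAt (fun t : ℝ => ((t, fun l => ω l * t + φ₀ l) : Pt d)) (1, ω) θ := by
    refine (hasDerivAt_id θ).prodMk (hasDerivAt_pi.2 fun l => ?_)
    simpa using ((hasDerivAt_id θ).const_mul (ω l)).add_const (φ₀ l)
  have hV : ∀ i, HasDerivAt (fun t : ℝ => 𝒱 (t, fun l => ω l * t + φ₀ l) i k)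
      ((𝒜 p * 𝒱 p - ν • (𝒱 p * Jmat)) i k) θ := fun i => by
    rw [← h𝒱.2.2.2.2 p]
    exact (((h𝒱.1 i k).differentiable one_ne_zero p).hasFDerivAt).comp_hasDerivAt θ hcurve
  have hsum := HasDerivAt.fun_sum (u := Finset.univ) fun i _ => (hV i).mul (hΦ.2 θ i j)
  have hJ : Jmat.transpose = -Jmat := by
    ext a b
    fin_cases a <;> fin_cases b <;> simp [Jmat]
  have halg : (𝒜 p * 𝒱 p - ν • (𝒱 p * Jmat)).transpose * Φ θ +
      (𝒱 p).transpose * (𝒜 p * Φ θ) = ν • (Jmat * ((𝒱 p).transpose * Φ θ)) := by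
    simp only [Matrix.transpose_sub, Matrix.transpose_mul, Matrix.transpose_smul, h𝒜skew, hJ]
    simp only [Matrix.mul_neg, Matrix.neg_mul, smul_neg, sub_neg_eq_add, Matrix.add_mul,
      Matrix.smul_mul, Matrix.mul_assoc]
    abel
  refine hsum.congr_deriv ?_
  rw [← halg, Matrix.add_apply, Matrix.mul_apply, Matrix.mul_apply, ← Finset.sum_add_distrib]
  rfl

/-- Theorem 9.1c. -/
theorem spectrum_of_principal_solution_subset {d : ℕ} (hd : 1 ≤ d) (ω : Fin d → ℝ)
    (𝒜 : Pt d → Matrix (Fin 3) (Fin 3) ℝ)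
    (h𝒜s : SmoothMat 1 𝒜) (h𝒜skew : ∀ p, (𝒜 p).transpose = -(𝒜 p))
    (h𝒜per : PeriodicPt 𝒜)
    (𝒱 : Pt d → Matrix (Fin 3) (Fin 3) ℝ) (ν : ℝ)
    (h𝒱 : IsUniformIFF ω 𝒜 𝒱 ν) :
    ∀ (φ₀ : Fin d → ℝ) (Φ : ℝ → Matrix (Fin 3) (Fin 3) ℝ),
      IsPrincipalSolution ω 𝒜 φ₀ Φ →
      ∀ lam : ℝ,
        (∀ ε : ℝ, (ε = -1 ∨ ε = 0 ∨ ε = 1) →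
          ∀ m : Fin (d + 1) → ℤ, lam ≠ ε * ν + zdot m (oneOmega ω)) →
        ∀ i j : Fin 3,
          Tendsto (fun T : ℝ => (1 / (T : ℂ)) *
              ∫ θ in (0:ℝ)..T, ((Φ θ i j : ℝ) : ℂ) * Complex.exp (-(Complex.I * lam * θ)))
            atTop (nhds 0) := by
  intro φ₀ Φ hΦ lam hlam i j
  change HasZeroMean _
  set γ : ℝ → Pt d := fun θ => (θ, fun l => ω l * θ + φ₀ l)
  set W : ℝ → Matrix (Fin 3) (Fin 3) ℝ := fun θ => (𝒱 (γ θ)).transpose * Φ θ with hW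
  have hΦW : ∀ θ, Φ θ = 𝒱 (γ θ) * W θ := fun θ => by
    rw [hW, ← Matrix.mul_assoc, mul_eq_one_comm.1 (h𝒱.2.2.1 (γ θ)).1, Matrix.one_mul]
  have hderiv : ∀ θ k, HasDerivAt (fun t => (W t k j : ℂ)) ((ν • (Jmat * W θ)) k j : ℝ) θ :=
    fun θ k => (h𝒱.hasDerivAt_transpose_mul h𝒜skew hΦ θ k j).ofReal_comp
  have hplus := eq_mul_exp_of_hasDerivAt (f := fun t => (W t 0 j : ℂ) + Complex.I * W t 1 j)
    (c := Complex.I * ν) fun θ => by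
      refine ((hderiv θ 0).add ((hderiv θ 1).const_mul Complex.I)).congr_deriv ?_
      simp only [Matrix.smul_apply, Matrix.mul_apply, Fin.sum_univ_three]
      simp [Jmat]
      linear_combination -(ν * W θ 1 j : ℂ) * Complex.I_sq
  have hminus := eq_mul_exp_of_hasDerivAt (f := fun t => (W t 0 j : ℂ) - Complex.I * W t 1 j)
    (c := -(Complex.I * ν)) fun θ => by
      refine ((hderiv θ 0).sub ((hderiv θ 1).const_mul Complex.I)).congr_deriv ?_
      simp only [Matrix.smul_apply, Matrix.mul_apply, Fin.sum_univ_three]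
      simp [Jmat]
      linear_combination -(ν * W θ 1 j : ℂ) * Complex.I_sq
  have hfix := eq_mul_exp_of_hasDerivAt (f := fun t => (W t 2 j : ℂ)) (c := 0) fun θ => by
      refine (hderiv θ 2).congr_deriv ?_
      simp only [Matrix.smul_apply, Matrix.mul_apply, Fin.sum_univ_three]
      simp [Jmat]
  have hVc : ∀ k, Continuous fun p => (𝒱 p i k : ℂ) := fun k =>
    Complex.continuous_ofReal.comp (h𝒱.1 i k).continuous
  have hper : ∀ a b c : ℂ,
      PeriodicPt fun p => a * 𝒱 p i 0 + b * 𝒱 p i 1 + c * 𝒱 p i 2 := fun a b c =>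
    ⟨fun p => by simp only [h𝒱.2.1.1 p], fun p l => by simp only [h𝒱.2.1.2 p l]⟩
  have hcont : ∀ a b c : ℂ,
      Continuous fun p => a * (𝒱 p i 0 : ℂ) + b * 𝒱 p i 1 + c * 𝒱 p i 2 := fun a b c =>
    ((continuous_const.mul (hVc 0)).add (continuous_const.mul (hVc 1))).add
      (continuous_const.mul (hVc 2))
  have hγc : Continuous γ := by fun_prop
  have hmean : ∀ (a b c : ℂ) (ε : ℝ), (ε = -1 ∨ ε = 0 ∨ ε = 1) → HasZeroMean fun θ =>
      (a * 𝒱 (γ θ) i 0 + b * 𝒱 (γ θ) i 1 + c * 𝒱 (γ θ) i 2) *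
        Complex.exp (-(Complex.I * (lam - ε * ν : ℝ) * θ)) := fun a b c ε hε =>
    (hper a b c).hasZeroMean (hcont a b c) ω φ₀ fun m h => hlam ε hε m (by linarith)
  have hmeanc : ∀ (a b c : ℂ) (ε : ℝ), Continuous fun θ : ℝ =>
      (a * 𝒱 (γ θ) i 0 + b * 𝒱 (γ θ) i 1 + c * 𝒱 (γ θ) i 2) *
        Complex.exp (-(Complex.I * (lam - ε * ν : ℝ) * θ)) := fun a b c ε =>
    ((hcont a b c).comp hγc).mul (by fun_prop)
  set zp : ℂ := (W 0 0 j : ℂ) + Complex.I * W 0 1 j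
  set zm : ℂ := (W 0 0 j : ℂ) - Complex.I * W 0 1 j
  convert ((hmean (zp / 2) (-(Complex.I * zp / 2)) 0 1 (by simp)).add
    (hmean (zm / 2) (Complex.I * zm / 2) 0 (-1) (by simp)) (hmeanc _ _ _ _) (hmeanc _ _ _ _)).add
    (hmean 0 0 (W 0 2 j) 0 (by simp))
    ((hmeanc _ _ _ _).add (hmeanc _ _ _ _)) (hmeanc _ _ _ _) using 2 with θ
  have hp := hplus θ
  have hm := hminus θ
  have hf := hfix θ
  rw [zero_mul, Complex.exp_zero, mul_one] at hf
  have hep : Complex.exp (-(Complex.I * (lam - 1 * ν : ℝ) * θ)) =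
      Complex.exp (Complex.I * ν * θ) * Complex.exp (-(Complex.I * lam * θ)) := by
    rw [← Complex.exp_add]
    congr 1
    push_cast
    ring
  have hem : Complex.exp (-(Complex.I * (lam - (-1) * ν : ℝ) * θ)) =
      Complex.exp (-(Complex.I * ν) * θ) * Complex.exp (-(Complex.I * lam * θ)) := by
    rw [← Complex.exp_add]
    congr 1
    push_cast
    ring
  have hΦij : (Φ θ i j : ℂ) =
      𝒱 (γ θ) i 0 * W θ 0 j + 𝒱 (γ θ) i 1 * W θ 1 j + 𝒱 (γ θ) i 2 * W θ 2 j := by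
    rw [hΦW θ, Matrix.mul_apply, Fin.sum_univ_three]
    push_cast
    rfl
  rw [hep, hem, hΦij, ← hf, show lam - 0 * ν = lam by ring]
  linear_combination Complex.exp (-(Complex.I * lam * θ)) *
    ((𝒱 (γ θ) i 0 - Complex.I * 𝒱 (γ θ) i 1) / 2 * hp +
      (𝒱 (γ θ) i 0 + Complex.I * 𝒱 (γ θ) i 1) / 2 * hm +
      (𝒱 (γ θ) i 1 : ℂ) * W θ 1 j * Complex.I_sq)
end
end
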